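/- arXiv:1109.2812 — 14 statements merged into one kernel-verified Lean document; each statement's English description precedes it below -/
import Mathlib

section
/- For all integers n ≥ 1 and ℓ ≥ 1, one has p(n,ℓ) · ∏_{j=1}^{n-1} (ℓ+j) = ∏_{j=1}^{n-1} lcm(1, 2, …, ⌊(ℓ+n-1)/j⌋); equivalently, p(n,ℓ) = ∏_{j=1}^{n-1} lcm(1,2,…,⌊(ℓ+n-1)/j⌋)/(ℓ+j). -/
/-- `p n ℓ` is the least common multiple of the multinomial coefficients
`ℓ! / (i₁! ⋯ iₙ!)` over all tuples `(i₁, …, iₙ) ∈ ℕⁿ` with `i₁ + ⋯ + iₙ = ℓ`. -/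
def multinomialLcm (n ℓ : ℕ) : ℕ :=
  (Finset.Nat.antidiagonalTuple n ℓ).lcm (fun i => Nat.multinomial Finset.univ i)

/-- `lcmUpTo m` is the least common multiple of `1, 2, …, m`. -/
def lcmUpTo (m : ℕ) : ℕ := (Finset.Icc 1 m).lcm id

theorem Nat.exists_fin_sum_eq_of_le_of_le {p d Q : ℕ} (hp : 1 ≤ p) (hd : d ≤ Q) (hQ : Q ≤ p * d) :
    ∃ c : Fin d → ℕ, (∀ t, 1 ≤ c t ∧ c t ≤ p) ∧ ∑ t, c t = Q := by
  induction d generalizing Q with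
  | zero => exact ⟨fun _ => 1, fun t => t.elim0, by simp at hQ ⊢; omega⟩
  | succ d ih =>
    rw [Nat.mul_succ] at hQ
    have hpd : d ≤ p * d := Nat.le_mul_of_pos_left d hp
    obtain ⟨c, hc, hsum⟩ := @ih (Q - max 1 (Q - p * d)) (by omega) (by omega)
    refine ⟨Fin.cons (max 1 (Q - p * d)) c, fun t => ?_, ?_⟩
    · cases t using Fin.cases with
      | zero => simp only [Fin.cons_zero]; omega
      | succ t => simpa using hc t
    · rw [Fin.sum_univ_succ]
      simp only [Fin.cons_zero, Fin.cons_succ, hsum]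
      omega

theorem Nat.sum_add_div_le_min_add_sum_div {d : ℕ} (i : Fin (d + 1) → ℕ) {q : ℕ} (hq : 0 < q) :
    (∑ t, i t + d) / q ≤ min d ((∑ t, i t + d) / q) + ∑ t, i t / q := by
  have key : ∑ t, (i t + 1) ≤ ∑ t, q * (i t / q + 1) :=
    Finset.sum_le_sum fun t _ => Nat.lt_mul_div_succ (i t) hq
  rw [← Finset.mul_sum] at key
  simp only [Finset.sum_add_distrib, Finset.sum_const, Finset.card_univ, Fintype.card_fin,
    smul_eq_mul, mul_one] at key
  have : (∑ t, i t + d) / q < ∑ t, i t / q + (d + 1) := by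
    rw [Nat.div_lt_iff_lt_mul hq, mul_comm]
    omega
  omega

/-- A single tuple minimizes `∑ t, i t / p ^ k` simultaneously for all `k`. -/
theorem Nat.exists_fin_sum_div_pow_eq {p : ℕ} (hp : 1 < p) (d l : ℕ) :
    ∃ i : Fin (d + 1) → ℕ, ∑ t, i t = l ∧
      ∀ k, min d ((l + d) / p ^ k) + ∑ t, i t / p ^ k = (l + d) / p ^ k := by
  obtain rfl | hd := Nat.eq_zero_or_pos d
  · exact ⟨fun _ => l, by simp, fun k => by simp⟩
  set N := l + d with hN
  set K := Nat.log p (N / d) with hK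
  have hNd : N / d ≠ 0 := (Nat.div_pos (by omega) hd).ne'
  have hP : 0 < p ^ K := by positivity
  have h₁ : d ≤ N / p ^ K := by
    rw [Nat.le_div_iff_mul_le hP, mul_comm, ← Nat.le_div_iff_mul_le hd]
    exact Nat.pow_log_le_self p hNd
  have h₂ : N / p ^ (K + 1) < d := by
    rw [Nat.div_lt_iff_lt_mul (by positivity), mul_comm, ← Nat.div_lt_iff_lt_mul hd]
    exact Nat.lt_pow_succ_log_self hp _
  have h₃ : N / p ^ K ≤ p * d := by
    rw [pow_succ, ← Nat.div_div_eq_div_mul, Nat.div_lt_iff_lt_mul (by omega), mul_comm] at h₂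
    exact h₂.le
  obtain ⟨c, hc, hsum⟩ := Nat.exists_fin_sum_eq_of_le_of_le hp.le h₁ h₃
  have hdm := Nat.div_add_mod N (p ^ K)
  have hpos : ∀ s, 0 < s → ∀ t, s * c t - 1 + 1 = s * c t := fun s hs t =>
    Nat.sub_add_cancel (Nat.mul_pos hs (hc t).1)
  have hred : ∀ s, 0 < s → ∑ t, (s * c t - 1) + d = s * (N / p ^ K) := fun s hs => by
    rw [← hsum, Finset.mul_sum, ← Finset.sum_congr rfl fun t _ => hpos s hs t]
    simp [Finset.sum_add_distrib]
  refine ⟨Fin.cons (N % p ^ K) fun t => p ^ K * c t - 1, ?_, fun k => ?_⟩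
  · simp only [Fin.sum_univ_succ, Fin.cons_zero, Fin.cons_succ]
    have := hred _ hP
    omega
  simp only [Fin.sum_univ_succ, Fin.cons_zero, Fin.cons_succ]
  have hq : 0 < p ^ k := by positivity
  obtain hk | hk := le_or_gt k K
  · obtain ⟨s, hs⟩ := pow_dvd_pow p hk
    have hs0 : 0 < s := Nat.pos_of_ne_zero fun h => by simp [h] at hs; omega
    have hdiv : ∀ t, (p ^ K * c t - 1) / p ^ k = s * c t - 1 := fun t => by
      have h := hpos s hs0 t
      rw [hs, mul_assoc, ← h]
      refine Nat.div_eq_of_lt_le ?_ ?_ <;> simp only [Nat.add_sub_cancel] <;> ring_nf <;> omega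
    have hNq : N / p ^ k = N % p ^ K / p ^ k + s * (N / p ^ K) := by
      conv_lhs => rw [← hdm]
      nth_rewrite 1 [hs]
      rw [mul_assoc, Nat.mul_add_div hq, add_comm]
    have hle : d ≤ N / p ^ k := h₁.trans (Nat.div_le_div_left (Nat.pow_le_pow_right hp.le hk) hq)
    simp only [hdiv]
    have := hred s hs0
    omega
  · have hpk : p ^ (K + 1) ≤ p ^ k := Nat.pow_le_pow_right hp.le hk
    have hle : N / p ^ k < d := (Nat.div_le_div_left hpk (by positivity)).trans_lt h₂
    have hzero : ∀ t, (p ^ K * c t - 1) / p ^ k = 0 := fun t => by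
      refine Nat.div_eq_of_lt ?_
      have h := Nat.mul_le_mul_left (p ^ K) (hc t).2
      rw [← pow_succ] at h
      have := hpos _ hP t
      omega
    have hmod : N % p ^ K / p ^ k = 0 :=
      Nat.div_eq_of_lt ((Nat.mod_lt _ hP).trans_le (Nat.pow_le_pow_right hp.le hk.le))
    simp only [hzero, hmod, Finset.sum_const_zero]
    omega

theorem Nat.log_eq_card_filter_Ico {p m b : ℕ} (hp : 1 < p) (hm : m ≠ 0) (hb : Nat.log p m < b) :
    Nat.log p m = {k ∈ Finset.Ico 1 b | p ^ k ≤ m}.card := by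
  have : {k ∈ Finset.Ico 1 b | p ^ k ≤ m} = Finset.Icc 1 (Nat.log p m) := by
    ext k
    simp only [Finset.mem_filter, Finset.mem_Ico, Finset.mem_Icc, ← Nat.le_log_iff_pow_le hp hm]
    omega
  simp [this]

theorem factorization_prod_lcmUpTo {p : ℕ} (hp : p.Prime) {d N b : ℕ} (hd : d ≤ N)
    (hb : Nat.log p N < b) :
    (∏ j ∈ Finset.Icc 1 d, lcmUpTo (N / j)).factorization p =
      ∑ k ∈ Finset.Ico 1 b, min d (N / p ^ k) := by
  rw [Nat.factorization_prod_apply (g := fun j => lcmUpTo (N / j)) fun j _ =>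
    Nat.lcmUpto_ne_zero (N / j)]
  have h : ∀ j ∈ Finset.Icc 1 d, (lcmUpTo (N / j)).factorization p =
      ∑ k ∈ Finset.Ico 1 b, if p ^ k ≤ N / j then 1 else 0 := fun j hj => by
    rw [Finset.mem_Icc] at hj
    rw [← Finset.card_filter, ← Nat.log_eq_card_filter_Ico hp.one_lt
      (Nat.div_pos (by omega) (by omega)).ne'
      ((Nat.log_mono_right (Nat.div_le_self N j)).trans_lt hb)]
    exact Nat.factorization_lcmUpto (N / j) hp
  rw [Finset.sum_congr rfl h, Finset.sum_comm]
  refine Finset.sum_congr rfl fun k _ => ?_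
  have : {j ∈ Finset.Icc 1 d | p ^ k ≤ N / j} = Finset.Icc 1 (min d (N / p ^ k)) := by
    ext j
    simp only [Finset.mem_filter, Finset.mem_Icc, le_min_iff, and_assoc]
    refine and_congr_right fun hj => and_congr_right fun _ => ?_
    rw [Nat.le_div_iff_mul_le hj, Nat.le_div_iff_mul_le (pow_pos hp.pos k), mul_comm]
  rw [← Finset.card_filter, this, Nat.card_Icc, Nat.add_sub_cancel]

open scoped Nat in
theorem factorization_multinomial_add_prod {p : ℕ} (hp : p.Prime) {d b : ℕ} (i : Fin (d + 1) → ℕ)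
    (hb : Nat.log p (∑ t, i t + d) < b) :
    (Nat.multinomial Finset.univ i).factorization p +
        (∏ j ∈ Finset.Icc 1 d, (∑ t, i t + j)).factorization p +
        ∑ k ∈ Finset.Ico 1 b, ∑ t, i t / p ^ k =
      ∑ k ∈ Finset.Ico 1 b, (∑ t, i t + d) / p ^ k := by
  have hfac : (∏ t, (i t)!) * Nat.multinomial Finset.univ i *
      ∏ j ∈ Finset.Icc 1 d, (∑ t, i t + j) = (∑ t, i t + d)! := by
    rw [Nat.multinomial_spec, ← Nat.factorial_mul_ascFactorial, Nat.ascFactorial_eq_prod_range,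
      Finset.range_eq_Ico, ← Finset.Ico_add_one_right_eq_Icc, Finset.prod_Ico_eq_prod_range,
      Finset.prod_Ico_eq_prod_range]
    simp [add_assoc]
  have hprod : ∏ j ∈ Finset.Icc 1 d, (∑ t, i t + j) ≠ 0 :=
    Finset.prod_ne_zero_iff.2 fun j hj => by rw [Finset.mem_Icc] at hj; omega
  have hfact : ∏ t, (i t)! ≠ 0 := (Nat.prod_factorial_pos _ _).ne'
  have hmult : Nat.multinomial Finset.univ i ≠ 0 := (Nat.multinomial_pos _ _).ne'
  have hi : ∀ t, ((i t)!).factorization p = ∑ k ∈ Finset.Ico 1 b, i t / p ^ k := fun t => by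
    refine Nat.factorization_factorial hp ((Nat.log_mono_right ?_).trans_lt hb)
    exact (Finset.single_le_sum (fun _ _ => Nat.zero_le _) (Finset.mem_univ t)).trans
      (Nat.le_add_right _ _)
  rw [← Nat.factorization_factorial hp hb, ← hfac, Nat.factorization_mul (by positivity) hprod,
    Nat.factorization_mul hfact hmult, Finsupp.add_apply, Finsupp.add_apply,
    Nat.factorization_prod_apply fun t _ => Nat.factorial_ne_zero (i t),
    Finset.sum_congr rfl fun t _ => hi t, Finset.sum_comm]
  ring

/-- **Theorem (lcm of multinomial coefficients).**
For all integers `n ≥ 1` and `ℓ ≥ 1`,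
`p(n,ℓ) · ∏_{j=1}^{n-1} (ℓ+j) = ∏_{j=1}^{n-1} lcm(1, 2, …, ⌊(ℓ+n-1)/j⌋)`. -/
theorem multinomialLcm_mul_prod_eq (n ℓ : ℕ) (hn : 1 ≤ n) (hl : 1 ≤ ℓ) :
    multinomialLcm n ℓ * ∏ j ∈ Finset.Icc 1 (n - 1), (ℓ + j) =
      ∏ j ∈ Finset.Icc 1 (n - 1), lcmUpTo ((ℓ + n - 1) / j) := by
  obtain ⟨d, rfl⟩ := Nat.exists_eq_add_of_le' hn
  rw [Nat.add_sub_cancel, ← add_assoc, Nat.add_sub_cancel]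
  have hmult : ∀ i ∈ Finset.Nat.antidiagonalTuple (d + 1) ℓ,
      Nat.multinomial Finset.univ i ≠ 0 := fun i _ => (Nat.multinomial_pos _ _).ne'
  have hlcm : multinomialLcm (d + 1) ℓ ≠ 0 := by
    simpa [multinomialLcm, Finset.lcm_eq_zero_iff] using hmult
  have hprod : ∏ j ∈ Finset.Icc 1 d, (ℓ + j) ≠ 0 :=
    Finset.prod_ne_zero_iff.2 fun j _ => by omega
  refine Nat.eq_of_factorization_eq (mul_ne_zero hlcm hprod)
    (Finset.prod_ne_zero_iff.2 fun j _ => Nat.lcmUpto_ne_zero _) fun p => ?_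
  by_cases hp : p.Prime
  swap
  · simp [Nat.factorization_eq_zero_of_not_prime, hp]
  have hb := Nat.lt_succ_self (Nat.log p (ℓ + d))
  rw [factorization_prod_lcmUpTo hp (Nat.le_add_left d ℓ) hb, Nat.factorization_mul hlcm hprod,
    Finsupp.add_apply, multinomialLcm, Finset.factorization_lcm hmult]
  refine le_antisymm ?_ ?_
  · obtain ⟨i, hi, hsup⟩ := Finset.exists_mem_eq_sup (Finset.Nat.antidiagonalTuple (d + 1) ℓ)
      ⟨Fin.cons ℓ 0, by simp [Finset.Nat.mem_antidiagonalTuple, Fin.sum_univ_succ]⟩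
      fun i => (Nat.multinomial Finset.univ i).factorization p
    rw [hsup]
    obtain rfl := Finset.Nat.mem_antidiagonalTuple.1 hi
    have h := Finset.sum_le_sum fun k (_ : k ∈ Finset.Ico 1 (Nat.log p (∑ t, i t + d)).succ) =>
      Nat.sum_add_div_le_min_add_sum_div i (pow_pos hp.pos k)
    rw [Finset.sum_add_distrib, ← factorization_multinomial_add_prod hp i hb] at h
    omega
  · obtain ⟨i, rfl, hi⟩ := Nat.exists_fin_sum_div_pow_eq hp.one_lt d ℓ
    have hle := Finset.le_sup (f := fun i => (Nat.multinomial Finset.univ i).factorization p)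
      (Finset.Nat.mem_antidiagonalTuple.2 (rfl : ∑ t, i t = ∑ t, i t))
    have h := Finset.sum_congr (rfl : Finset.Ico 1 (Nat.log p (∑ t, i t + d)).succ = _)
      fun k _ => hi k
    rw [Finset.sum_add_distrib, ← factorization_multinomial_add_prod hp i hb] at h
    omega
end

section
/- For all integers n ≥ 2 and ℓ ≥ 1, the product ∏_{k=1}^{n-1} lcm(1, 2, …, ⌊(ℓ+n-1)/k⌋) divides the least common multiple of the products j₁·j₂⋯j_{n-1} taken over all strictly decreasing tuples of integers 1 ≤ j_{n-1} < j_{n-2} < ⋯ < j₁ ≤ ℓ+n-1. -/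
/-- `strictAntiProdLcm n ℓ` is the least common multiple of the products
`j₁ ⋯ j_{n-1}` over all strictly decreasing tuples of integers
`1 ≤ j_{n-1} < ⋯ < j₁ ≤ ℓ+n-1` (indices increase as values decrease). -/
def strictAntiProdLcm (n ℓ : ℕ) : ℕ :=
  ((Fintype.piFinset fun _ : Fin (n - 1) => Finset.Icc 1 (ℓ + n - 1)).filter
    (fun j => ∀ a b : Fin (n - 1), a < b → j b < j a)).lcm (fun j => ∏ h, j h)

theorem factorization_lcmUpTo_le {p : ℕ} (hp : p.Prime) (m : ℕ) :
    (lcmUpTo m).factorization p ≤ Nat.log p m := by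
  rw [lcmUpTo, Finset.factorization_lcm fun x hx => by
    simpa using Nat.pos_iff_ne_zero.1 (Finset.mem_Icc.1 hx).1]
  refine Finset.sup_le fun x hx => ?_
  rw [Finset.mem_Icc] at hx
  exact Nat.le_log_of_pow_le hp.one_lt ((Nat.ordProj_le p (Nat.pos_iff_ne_zero.1 hx.1)).trans hx.2)

open Finset in
/-- Among the integers `1, …, M` there are `r` whose divisibility by every power of `p`
is as frequent as possible. -/
theorem exists_subset_Icc_min_le_card_filter_pow_dvd {p M r : ℕ} (hp : 1 < p)
    (hr0 : 0 < r) (hr : r ≤ M) :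
    ∃ S ⊆ Icc 1 M, #S = r ∧ ∀ i, min r (M / p ^ i) ≤ #{s ∈ S | p ^ i ∣ s} := by
  let A : ℕ → Finset ℕ := fun i => {s ∈ Ioc 0 M | p ^ i ∣ s}
  have hA : ∀ i, #(A i) = M / p ^ i := fun i => Nat.Ioc_filter_dvd_card_eq_div M (p ^ i)
  have hanti : ∀ {i j}, i ≤ j → A j ⊆ A i := fun hij x hx => by
    simp only [A, mem_filter] at hx ⊢
    exact ⟨hx.1, (pow_dvd_pow p hij).trans hx.2⟩
  have hex : ∃ i, #(A i) < r :=
    ⟨M, by rw [hA, Nat.div_eq_of_lt (Nat.lt_pow_self hp)]; exact hr0⟩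
  obtain ⟨i, hi⟩ : ∃ i, Nat.find hex = i + 1 := by
    refine Nat.exists_eq_succ_of_ne_zero fun h => ?_
    have := Nat.find_spec hex
    rw [h, hA] at this
    simp at this
    omega
  have hlt : #(A (i + 1)) < r := hi ▸ Nat.find_spec hex
  have hle : r ≤ #(A i) := not_lt.1 (Nat.find_min hex (by omega))
  obtain ⟨S, hS₁, hS₂, hS⟩ := exists_subsuperset_card_eq (hanti i.le_succ) hlt.le hle
  refine ⟨S, fun x hx => ?_, hS, fun j => ?_⟩
  · have := hS₂ hx
    simp only [A, mem_filter, mem_Ioc, mem_Icc] at this ⊢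
    omega
  · rcases le_or_gt j i with hj | hj
    · rw [filter_true_of_mem fun x hx => (mem_filter.1 (hanti hj (hS₂ hx))).2, hS]
      exact min_le_left _ _
    · rw [← hA]
      refine (min_le_right _ _).trans (card_le_card fun x hx => ?_)
      exact mem_filter.2 ⟨hS₁ (hanti hj hx), (mem_filter.1 hx).2⟩

open Finset in
theorem prod_dvd_strictAntiProdLcm {n ℓ : ℕ} {S : Finset ℕ} (hS : S ⊆ Icc 1 (ℓ + n - 1))
    (hcard : #S = n - 1) : (∏ s ∈ S, s) ∣ strictAntiProdLcm n ℓ := by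
  let j : Fin (n - 1) → ℕ := fun a => S.orderIsoOfFin hcard a.rev
  have hj : ∏ a, j a = ∏ s ∈ S, s := by
    rw [← prod_coe_sort S]
    exact Fintype.prod_equiv (Fin.revPerm.trans (S.orderIsoOfFin hcard).toEquiv) _ _ fun _ => rfl
  rw [← hj]
  refine dvd_lcm (f := fun j : Fin (n - 1) → ℕ => ∏ h, j h) (mem_filter.2 ⟨?_, fun a b hab => ?_⟩)
  · exact Fintype.mem_piFinset.2 fun a => hS (S.orderIsoOfFin hcard a.rev).2
  · exact (S.orderIsoOfFin hcard).strictMono (Fin.rev_lt_rev.2 hab)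

theorem strictAntiProdLcm_ne_zero (n ℓ : ℕ) : strictAntiProdLcm n ℓ ≠ 0 := by
  rw [strictAntiProdLcm, Ne, Finset.lcm_eq_zero_iff]
  rintro ⟨j, hj, h⟩
  have hmem := Fintype.mem_piFinset.1 (Finset.mem_filter.1 hj).1
  exact Finset.prod_ne_zero_iff.2
    (fun a _ => Nat.pos_iff_ne_zero.1 (Finset.mem_Icc.1 (hmem a)).1) h

open Finset in
theorem sum_log_div_le_sum_min {p : ℕ} (hp : 1 < p) (M r : ℕ) :
    ∑ k ∈ Icc 1 r, Nat.log p (M / k) ≤ ∑ i ∈ Ico 1 (M + 1), min r (M / p ^ i) := by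
  have hlog : ∀ k ∈ Icc 1 r, Nat.log p (M / k) ≤ #{i ∈ Ico 1 (M + 1) | k * p ^ i ≤ M} := by
    intro k hk
    have hk0 : 0 < k := (mem_Icc.1 hk).1
    calc Nat.log p (M / k) = #(Icc 1 (Nat.log p (M / k))) := by simp
      _ ≤ _ := card_le_card fun i hi => by
        rw [mem_Icc] at hi
        have hne : M / k ≠ 0 := fun h => by
          rw [h, Nat.log_zero_right] at hi
          omega
        have hpow := (Nat.le_div_iff_mul_le hk0).1 (Nat.pow_le_of_le_log hne hi.2)
        have hiM : i < p ^ i := Nat.lt_pow_self hp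
        have := Nat.le_mul_of_pos_right (p ^ i) hk0
        rw [mem_filter, mem_Ico, mul_comm k]
        exact ⟨⟨hi.1, by omega⟩, hpow⟩
  refine (sum_le_sum hlog).trans ?_
  simp_rw [card_filter]
  rw [sum_comm]
  refine sum_le_sum fun i _ => ?_
  rw [← card_filter]
  calc #{k ∈ Icc 1 r | k * p ^ i ≤ M} ≤ #(Icc 1 (min r (M / p ^ i))) :=
        card_le_card fun k hk => by
          rw [mem_filter, mem_Icc] at hk
          rw [mem_Icc, le_min_iff, Nat.le_div_iff_mul_le (by positivity)]
          exact ⟨hk.1.1, hk.1.2, hk.2⟩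
    _ = _ := by simp

open Finset in
theorem factorization_prod_eq_sum_card_filter_pow_dvd {p M : ℕ} (hp : p.Prime) {S : Finset ℕ}
    (hS : S ⊆ Icc 1 M) :
    (∏ s ∈ S, s).factorization p = ∑ i ∈ Ico 1 (M + 1), #{s ∈ S | p ^ i ∣ s} := by
  rw [Nat.factorization_prod fun s hs => Nat.pos_iff_ne_zero.1 (mem_Icc.1 (hS hs)).1,
    Finsupp.finsetSum_apply]
  simp_rw [card_filter]
  rw [sum_comm]
  refine sum_congr rfl fun s hs => ?_
  have hs' := mem_Icc.1 (hS hs)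
  rw [← card_filter]
  have hlt : M + 1 < p ^ (M + 1) := Nat.lt_pow_self hp.one_lt
  exact Nat.factorization_eq_card_pow_dvd_of_lt hp hs'.1 (by omega)

/-- For all integers `n ≥ 2` and `ℓ ≥ 1`, the product
`∏_{k=1}^{n-1} lcm(1, 2, …, ⌊(ℓ+n-1)/k⌋)` divides the lcm of the products
`j₁ ⋯ j_{n-1}` over all strictly decreasing tuples `1 ≤ j_{n-1} < ⋯ < j₁ ≤ ℓ+n-1`. -/
theorem prod_lcmUpTo_dvd_strictAntiProdLcm (n ℓ : ℕ) (hn : 2 ≤ n) (hl : 1 ≤ ℓ) :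
    (∏ k ∈ Finset.Icc 1 (n - 1), lcmUpTo ((ℓ + n - 1) / k)) ∣ strictAntiProdLcm n ℓ := by
  have hlcm : ∀ m, lcmUpTo m ≠ 0 := fun m => by simp [lcmUpTo, Finset.lcm_eq_zero_iff]
  refine (Nat.factorization_prime_le_iff_dvd (Finset.prod_ne_zero_iff.2 fun k _ => hlcm _)
    (strictAntiProdLcm_ne_zero n ℓ)).1 fun p hp => ?_
  obtain ⟨S, hS, hcard, hmin⟩ := exists_subset_Icc_min_le_card_filter_pow_dvd
    (M := ℓ + n - 1) (r := n - 1) hp.one_lt (by omega) (by omega)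
  calc (∏ k ∈ Finset.Icc 1 (n - 1), lcmUpTo ((ℓ + n - 1) / k)).factorization p
      = ∑ k ∈ Finset.Icc 1 (n - 1), (lcmUpTo ((ℓ + n - 1) / k)).factorization p := by
        rw [Nat.factorization_prod fun k _ => hlcm _, Finsupp.finsetSum_apply]
    _ ≤ ∑ k ∈ Finset.Icc 1 (n - 1), Nat.log p ((ℓ + n - 1) / k) :=
        Finset.sum_le_sum fun k _ => factorization_lcmUpTo_le hp _
    _ ≤ _ := sum_log_div_le_sum_min hp.one_lt _ _
    _ ≤ _ := Finset.sum_le_sum fun i _ => hmin i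
    _ = (∏ s ∈ S, s).factorization p :=
        (factorization_prod_eq_sum_card_filter_pow_dvd hp hS).symm
    _ ≤ _ := (Nat.factorization_le_iff_dvd
        (Finset.prod_ne_zero_iff.2 fun s hs => Nat.pos_iff_ne_zero.1 (Finset.mem_Icc.1 (hS hs)).1)
        (strictAntiProdLcm_ne_zero n ℓ)).2 (prod_dvd_strictAntiProdLcm hS hcard) p
end

section
/- For all integers n ≥ 2 and ℓ ≥ 1, the least common multiple of the products j₁·j₂⋯j_{n-1} over all strictly decreasing tuples of integers 1 ≤ j_{n-1} < j_{n-2} < ⋯ < j₁ ≤ ℓ+n-1 divides q(n,ℓ) := ((ℓ+n-1)!/ℓ!) · p(n,ℓ). -/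
/-- `q n ℓ = ((ℓ+n-1)!/ℓ!) · p(n,ℓ)`. -/
def qAux (n ℓ : ℕ) : ℕ :=
  (Nat.factorial (ℓ + n - 1) / Nat.factorial ℓ) * multinomialLcm n ℓ

open Nat in
/-- The gaps left in `{1, …, N}` by a strictly decreasing tuple `j` are runs of consecutive
integers, so the product of their elements is divisible by the product of the factorials of
their lengths `i`. -/
lemma exists_gaps_prod_mul_prod_factorial_dvd (m N : ℕ) (j : Fin m → ℕ)
    (hj : ∀ a, 1 ≤ j a ∧ j a ≤ N) (hanti : StrictAnti j) :
    ∃ i : Fin (m + 1) → ℕ, ∑ k, i k + m = N ∧ (∏ a, j a) * ∏ k, (i k)! ∣ N ! := by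
  induction m generalizing N with
  | zero => exact ⟨fun _ => N, by simp, by simp⟩
  | succ m ih =>
    obtain ⟨h1, hN⟩ := hj 0
    obtain ⟨i, hsum, hdvd⟩ := ih (j 0 - 1) (fun a => j a.succ)
      (fun a => ⟨(hj _).1, Nat.le_sub_one_of_lt (hanti a.succ_pos)⟩)
      (fun a b hab => hanti (Fin.succ_lt_succ_iff.2 hab))
    refine ⟨Fin.cons (N - j 0) i, ?_, ?_⟩
    · rw [Fin.sum_univ_succ]
      simp only [Fin.cons_zero, Fin.cons_succ]
      omega
    · rw [Fin.prod_univ_succ, Fin.prod_univ_succ (n := m + 1)]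
      simp only [Fin.cons_zero, Fin.cons_succ]
      calc _ = j 0 * ((∏ a : Fin m, j a.succ) * ∏ k, (i k)!) * (N - j 0)! := by ring
        _ ∣ j 0 * (j 0 - 1)! * (N - j 0)! := by gcongr
        _ = (j 0)! * (N - j 0)! := by rw [Nat.mul_factorial_pred (by omega)]
        _ ∣ N ! := Nat.factorial_mul_factorial_dvd_factorial hN

/-- For all integers `n ≥ 2` and `ℓ ≥ 1`, the lcm of the products `j₁ ⋯ j_{n-1}`
over all strictly decreasing tuples `1 ≤ j_{n-1} < ⋯ < j₁ ≤ ℓ+n-1` divides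
`q(n,ℓ) = ((ℓ+n-1)!/ℓ!) · p(n,ℓ)`. -/
theorem strictAntiProdLcm_dvd_q (n ℓ : ℕ) (hn : 2 ≤ n) (hl : 1 ≤ ℓ) :
    strictAntiProdLcm n ℓ ∣ qAux n ℓ := by
  obtain ⟨m, rfl⟩ : ∃ m, n = m + 1 := ⟨n - 1, by omega⟩
  refine Finset.lcm_dvd fun j hj => ?_
  simp only [Finset.mem_filter, Fintype.mem_piFinset, Finset.mem_Icc] at hj
  obtain ⟨i, hsum, hdvd⟩ :=
    exists_gaps_prod_mul_prod_factorial_dvd m (ℓ + m) j hj.1 (fun a b => hj.2 a b)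
  have hi : ∑ k, i k = ℓ := by omega
  have hmem : Nat.multinomial Finset.univ i ∣ multinomialLcm (m + 1) ℓ :=
    Finset.dvd_lcm (f := fun i => Nat.multinomial Finset.univ i)
      (Finset.Nat.mem_antidiagonalTuple.2 hi)
  refine dvd_trans ?_ (mul_dvd_mul_left _ hmem)
  have hpos : 0 < ∏ k, (i k).factorial := Finset.prod_pos fun k _ => Nat.factorial_pos _
  refine Nat.dvd_of_mul_dvd_mul_right hpos ?_
  rwa [mul_assoc, mul_comm (Nat.multinomial _ _), Nat.multinomial_spec, hi,
    Nat.div_mul_cancel (Nat.factorial_dvd_factorial (by omega))]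
end

section
/- For all integers n ≥ 1 and ℓ ≥ 2, the integer q(n,ℓ-1) divides q(n,ℓ), i.e. ((ℓ+n-2)!/(ℓ-1)!)·p(n,ℓ-1) divides ((ℓ+n-1)!/ℓ!)·p(n,ℓ). -/
theorem sum_update_succ {α : Type*} [Fintype α] [DecidableEq α] (i : α → ℕ) (k : α) :
    ∑ a, Function.update i k (i k + 1) a = ∑ a, i a + 1 := by
  rw [Finset.sum_update_of_mem (Finset.mem_univ k),
    ← Finset.add_sum_erase _ i (Finset.mem_univ k), Finset.sdiff_singleton_eq_erase]
  ring

/-- Raising the `k`-th entry of `i` by one multiplies the multinomial coefficient by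
`(∑ i + 1) / (i k + 1)`. -/
theorem Nat.succ_sum_mul_multinomial {α : Type*} [Fintype α] [DecidableEq α] (i : α → ℕ) (k : α) :
    (∑ a, i a + 1) * Nat.multinomial Finset.univ i =
      (i k + 1) * Nat.multinomial Finset.univ (Function.update i k (i k + 1)) := by
  have hprod : ∏ a, (Function.update i k (i k + 1) a).factorial =
      (i k + 1) * ∏ a, (i a).factorial := by
    rw [← Finset.mul_prod_erase _ _ (Finset.mem_univ k),
      ← Finset.mul_prod_erase _ (fun a => (i a).factorial) (Finset.mem_univ k),
      Function.update_self, Nat.factorial_succ, mul_assoc]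
    congr 2
    refine Finset.prod_congr rfl fun a ha => ?_
    rw [Function.update_of_ne (Finset.ne_of_mem_erase ha)]
  have h₁ := Nat.multinomial_spec Finset.univ i
  have h₂ := Nat.multinomial_spec Finset.univ (Function.update i k (i k + 1))
  rw [hprod, sum_update_succ, Nat.factorial_succ, ← h₁] at h₂
  have hpos : 0 < ∏ a, (i a).factorial := Finset.prod_pos fun a _ => Nat.factorial_pos _
  refine Nat.eq_of_mul_eq_mul_left hpos ?_
  linarith

theorem Nat.mul_finset_lcm_dvd {β : Type*} {s : Finset β} (hs : s.Nonempty) {f : β → ℕ} {a c : ℕ}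
    (ha : 0 < a) (h : ∀ b ∈ s, a * f b ∣ c) : a * s.lcm f ∣ c := by
  obtain ⟨b, hb⟩ := hs
  obtain ⟨d, rfl⟩ := (Nat.dvd_mul_right a (f b)).trans (h b hb)
  exact mul_dvd_mul_left a (Finset.lcm_dvd fun b hb => Nat.dvd_of_mul_dvd_mul_left ha (h b hb))

theorem succ_mul_multinomialLcm_dvd {n : ℕ} (hn : 0 < n) (m : ℕ) :
    (m + 1) * multinomialLcm n m ∣ (m + n) * multinomialLcm n (m + 1) := by
  refine Nat.mul_finset_lcm_dvd ⟨Pi.single ⟨0, hn⟩ m, ?_⟩ m.succ_pos fun i hi => ?_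
  · simp [Finset.Nat.mem_antidiagonalTuple]
  rw [Finset.Nat.mem_antidiagonalTuple] at hi
  have hsum : (m + n) * multinomialLcm n (m + 1) =
      ∑ k, (i k + 1) * multinomialLcm n (m + 1) := by
    rw [← Finset.sum_mul, Finset.sum_add_distrib, hi]
    simp
  rw [hsum]
  refine Finset.dvd_sum fun k _ => ?_
  have hk := Nat.succ_sum_mul_multinomial i k
  rw [hi] at hk
  rw [hk]
  refine mul_dvd_mul_left _ (Finset.dvd_lcm ?_)
  rw [Finset.Nat.mem_antidiagonalTuple, sum_update_succ, hi]

/-- For all integers `n ≥ 1` and `ℓ ≥ 2`, the integer `q(n,ℓ-1)` divides `q(n,ℓ)`,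
i.e. `((ℓ+n-2)!/(ℓ-1)!)·p(n,ℓ-1)` divides `((ℓ+n-1)!/ℓ!)·p(n,ℓ)`. -/
theorem q_pred_dvd_q (n ℓ : ℕ) (hn : 1 ≤ n) (hl : 2 ≤ ℓ) :
    qAux n (ℓ - 1) ∣ qAux n ℓ := by
  obtain ⟨m, rfl⟩ : ∃ m, ℓ = m + 1 := ⟨ℓ - 1, by omega⟩
  obtain ⟨r, rfl⟩ : ∃ r, n = r + 1 := ⟨n - 1, by omega⟩
  have hquot : (m + 1) * ((m + 1 + r).factorial / (m + 1).factorial) =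
      (m + (r + 1)) * ((m + r).factorial / m.factorial) := by
    rw [← Nat.ascFactorial_eq_div, ← Nat.ascFactorial_eq_div, Nat.succ_ascFactorial]
    ring
  simp only [qAux, Nat.add_sub_cancel, ← Nat.add_assoc]
  refine Nat.dvd_of_mul_dvd_mul_left m.succ_pos ?_
  rw [Nat.succ_eq_add_one, ← mul_assoc (m + 1) (_ / _) (multinomialLcm _ (m + 1)), hquot]
  rw [mul_left_comm (m + 1), mul_comm (m + (r + 1)), mul_assoc]
  exact mul_dvd_mul_left _ (succ_mul_multinomialLcm_dvd hn m)
end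

section
/- For all integers n ≥ 2 and ℓ ≥ 1, the integer q(n,ℓ) divides lcm(1, 2, …, ⌊1 + ℓ/(n-1)⌋) · q(n-1, ℓ+1). -/
/-- A total `t ≤ m * c` can be split into `m` parts, each at most `c`. -/
theorem exists_sum_eq_of_le_mul (c : ℕ) :
    ∀ m t : ℕ, t ≤ m * c → ∃ d : Fin m → ℕ, (∀ k, d k ≤ c) ∧ ∑ k, d k = t := by
  intro m
  induction m with
  | zero => exact fun t ht => ⟨fun _ => 0, fun _ => Nat.zero_le _, by simpa using by omega⟩
  | succ m ih =>
    intro t ht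
    obtain ⟨d, hd, hsum⟩ := ih (t - c) (by rw [Nat.succ_mul] at ht; omega)
    refine ⟨Fin.cons (min t c) d, Fin.cases (by simp) (by simpa using hd), ?_⟩
    rw [Fin.sum_univ_succ]
    simp only [Fin.cons_zero, Fin.cons_succ, hsum]
    omega

/-- There is a tuple of `M + 1` naturals of sum `N` which simultaneously minimises
all the sums `∑ k, ⌊j k / p ^ e⌋`. -/
theorem exists_sum_div_pow_le {p : ℕ} (hp : 2 ≤ p) (M N : ℕ) :
    ∃ j : Fin (M + 1) → ℕ, ∑ k, j k = N ∧
      ∀ e, ∑ k, j k / p ^ e ≤ (N - M * (p ^ e - 1)) / p ^ e := by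
  induction N using Nat.strong_induction_on with
  | _ N ih =>
    rcases Nat.eq_zero_or_pos N with rfl | hN
    · exact ⟨fun _ => 0, by simp⟩
    set N' := (N - M * (p - 1)) / p with hN'
    have hle : p * N' ≤ N - M * (p - 1) := Nat.mul_div_le _ _
    have hlt : N - M * (p - 1) < p * N' + p := Nat.lt_mul_div_succ _ (by omega)
    have h2 : 2 * N' ≤ p * N' := Nat.mul_le_mul_right _ hp
    obtain ⟨j, hj, hje⟩ := ih N' (by omega)
    obtain ⟨d, hd, hds⟩ := exists_sum_eq_of_le_mul (p - 1) (M + 1) (N - p * N')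
      (by rw [Nat.succ_mul]; omega)
    have hsum : ∑ k, (p * j k + d k) = N := by
      rw [Finset.sum_add_distrib, ← Finset.mul_sum, hj, hds]
      omega
    refine ⟨fun k => p * j k + d k, hsum, fun e => ?_⟩
    cases e with
    | zero => simp [hsum]
    | succ e =>
      have hdiv : ∀ k, (p * j k + d k) / p ^ (e + 1) = j k / p ^ e := fun k => by
        rw [pow_succ', ← Nat.div_div_eq_div_mul, Nat.mul_add_div (by omega),
          Nat.div_eq_of_lt ((hd k).trans_lt (Nat.sub_lt (by omega) one_pos)), add_zero]
      have hsub : p ^ (e + 1) - 1 = (p - 1) + p * (p ^ e - 1) := by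
        have : p * 1 ≤ p * p ^ e := Nat.mul_le_mul_left _ (Nat.one_le_pow _ _ (by omega))
        rw [Nat.mul_sub, pow_succ']
        omega
      simp only [hdiv]
      refine (hje e).trans_eq ?_
      rw [hN', hsub, pow_succ', ← Nat.div_div_eq_div_mul, mul_add, ← Nat.sub_sub,
        Nat.mul_left_comm M p, Nat.sub_mul_div]

theorem sub_mul_div_le_sum_div_add_ite {M ℓ q : ℕ} (hq : 1 ≤ q) (i : Fin (M + 2) → ℕ)
    (hi : ∑ k, i k = ℓ) :
    (ℓ + 1 - M * (q - 1)) / q ≤ ∑ k, i k / q + if q ≤ 1 + ℓ / (M + 1) then 1 else 0 := by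
  split_ifs with h
  · have hmod : ∑ k, i k % q ≤ (M + 2) * (q - 1) := by
      simpa using Finset.sum_le_card_nsmul Finset.univ (fun k => i k % q) (q - 1)
        fun k _ => Nat.le_sub_one_of_lt (Nat.mod_lt _ hq)
    have hdecomp : ℓ = q * ∑ k, i k / q + ∑ k, i k % q := by
      rw [Finset.mul_sum, ← Finset.sum_add_distrib, ← hi]
      exact Finset.sum_congr rfl fun k _ => (Nat.div_add_mod _ _).symm
    refine Nat.le_of_lt_succ ((Nat.div_lt_iff_lt_mul hq).2 ?_)
    rw [Nat.add_mul] at hmod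
    rw [Nat.succ_eq_add_one, Nat.add_mul, Nat.add_mul, Nat.mul_comm _ q]
    omega
  · have hlt : ℓ < (q - 1) * (M + 1) := (Nat.div_lt_iff_lt_mul (by omega)).1 (by omega)
    rw [Nat.mul_add, Nat.mul_comm] at hlt
    rw [Nat.div_eq_of_lt (by omega)]
    exact Nat.zero_le _

theorem lcmUpTo_ne_zero (m : ℕ) : lcmUpTo m ≠ 0 := by
  simp [lcmUpTo, Finset.lcm_eq_zero_iff]

theorem log_le_factorization_lcmUpTo {p m : ℕ} (hp : p.Prime) (hm : m ≠ 0) :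
    Nat.log p m ≤ (lcmUpTo m).factorization p := by
  rw [← hp.pow_dvd_iff_le_factorization (lcmUpTo_ne_zero m)]
  exact Finset.dvd_lcm (f := id)
    (Finset.mem_Icc.2 ⟨Nat.one_le_pow _ _ hp.pos, Nat.pow_log_le_self p hm⟩)

theorem factorization_prod_factorial {p b n N : ℕ} (hp : p.Prime) (hb : Nat.log p N < b)
    (i : Fin n → ℕ) (hi : ∑ k, i k ≤ N) :
    (∏ k, (i k).factorial).factorization p = ∑ e ∈ Finset.Ico 1 b, ∑ k, i k / p ^ e := by
  rw [Nat.factorization_prod_apply fun k _ => Nat.factorial_ne_zero _, Finset.sum_comm]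
  refine Finset.sum_congr rfl fun k _ => Nat.factorization_factorial hp ?_
  have hk : i k ≤ N := (Finset.single_le_sum (fun _ _ => Nat.zero_le _) (Finset.mem_univ k)).trans hi
  exact (Nat.log_mono_right hk).trans_lt hb

theorem multinomialLcm_ne_zero (n ℓ : ℕ) : multinomialLcm n ℓ ≠ 0 := by
  simp only [multinomialLcm, ne_eq, Finset.lcm_eq_zero_iff, not_exists, not_and]
  exact fun i _ => (Nat.multinomial_pos _ _).ne'

theorem succ_mul_multinomial_dvd {M ℓ : ℕ} (i : Fin (M + 2) → ℕ) (hi : ∑ k, i k = ℓ) :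
    (ℓ + 1) * Nat.multinomial Finset.univ i ∣
      lcmUpTo (1 + ℓ / (M + 1)) * multinomialLcm (M + 1) (ℓ + 1) := by
  have hA : (ℓ + 1) * Nat.multinomial Finset.univ i ≠ 0 :=
    mul_ne_zero (by omega) (Nat.multinomial_pos _ _).ne'
  rw [← Nat.factorization_prime_le_iff_dvd hA
    (mul_ne_zero (lcmUpTo_ne_zero _) (multinomialLcm_ne_zero _ _))]
  intro p hp
  obtain ⟨j, hj, hje⟩ := exists_sum_div_pow_le hp.two_le M (ℓ + 1)
  have hmul : ((ℓ + 1) * Nat.multinomial Finset.univ i) * ∏ k, (i k).factorial =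
      Nat.multinomial Finset.univ j * ∏ k, (j k).factorial := by
    have h1 := Nat.multinomial_spec Finset.univ i
    have h2 := Nat.multinomial_spec Finset.univ j
    rw [hi] at h1
    rw [hj, Nat.factorial_succ, ← h1] at h2
    rw [mul_comm (Nat.multinomial Finset.univ j), h2]
    ring
  have hfact := congrArg (fun x => x.factorization p) hmul
  have hprod : ∀ {n : ℕ} (f : Fin n → ℕ), ∏ k, (f k).factorial ≠ 0 := fun f =>
    Finset.prod_ne_zero_iff.2 fun k _ => Nat.factorial_ne_zero _
  rw [Nat.factorization_mul hA (hprod i), Finsupp.add_apply,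
    Nat.factorization_mul (Nat.multinomial_pos _ _).ne' (hprod j), Finsupp.add_apply,
    factorization_prod_factorial hp (Nat.lt_succ_self (Nat.log p (ℓ + 1))) i (by omega),
    factorization_prod_factorial hp (Nat.lt_succ_self (Nat.log p (ℓ + 1))) j hj.le] at hfact
  have hle := Finset.sum_le_sum fun e (_ : e ∈ Finset.Ico 1 (Nat.log p (ℓ + 1)).succ) =>
    (hje e).trans (sub_mul_div_le_sum_div_add_ite (Nat.one_le_pow e p hp.pos) i hi)
  rw [Finset.sum_add_distrib, ← Finset.card_filter] at hle
  have hcard : ((Finset.Ico 1 (Nat.log p (ℓ + 1)).succ).filter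
      fun e => p ^ e ≤ 1 + ℓ / (M + 1)).card ≤ Nat.log p (1 + ℓ / (M + 1)) := by
    refine (Finset.card_le_card (t := Finset.Icc 1 (Nat.log p (1 + ℓ / (M + 1)))) ?_).trans
      (by simp)
    intro e he
    rw [Finset.mem_filter, Finset.mem_Ico] at he
    exact Finset.mem_Icc.2 ⟨he.1.1, Nat.le_log_of_pow_le hp.one_lt he.2⟩
  have hL := log_le_factorization_lcmUpTo hp (m := 1 + ℓ / (M + 1)) (by positivity)
  have hdvd : Nat.multinomial Finset.univ j ∣ multinomialLcm (M + 1) (ℓ + 1) :=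
    Finset.dvd_lcm (f := fun i => Nat.multinomial Finset.univ i)
      (Finset.Nat.mem_antidiagonalTuple.2 hj)
  have hP := (Nat.factorization_le_iff_dvd (Nat.multinomial_pos _ _).ne'
    (multinomialLcm_ne_zero _ _)).2 hdvd p
  rw [Nat.factorization_mul (lcmUpTo_ne_zero _) (multinomialLcm_ne_zero _ _),
    Finsupp.add_apply]
  omega

theorem succ_mul_multinomialLcm_dvd_s4 (M ℓ : ℕ) :
    (ℓ + 1) * multinomialLcm (M + 2) ℓ ∣
      lcmUpTo (1 + ℓ / (M + 1)) * multinomialLcm (M + 1) (ℓ + 1) := by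
  obtain ⟨Z, hZ⟩ : ℓ + 1 ∣ lcmUpTo (1 + ℓ / (M + 1)) * multinomialLcm (M + 1) (ℓ + 1) :=
    (dvd_mul_right _ _).trans (succ_mul_multinomial_dvd (Pi.single 0 ℓ) (by simp))
  rw [hZ]
  refine mul_dvd_mul_left _ (Finset.lcm_dvd fun i hi => ?_)
  have h := succ_mul_multinomial_dvd i (Finset.Nat.mem_antidiagonalTuple.1 hi)
  rw [hZ] at h
  exact Nat.dvd_of_mul_dvd_mul_left ℓ.succ_pos h

/-- For all integers `n ≥ 2` and `ℓ ≥ 1`, `q(n,ℓ)` divides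
`lcm(1, 2, …, ⌊1 + ℓ/(n-1)⌋) · q(n-1, ℓ+1)`. -/
theorem q_dvd_lcmUpTo_mul_q (n ℓ : ℕ) (hn : 2 ≤ n) (hl : 1 ≤ ℓ) :
    qAux n ℓ ∣ lcmUpTo (1 + ℓ / (n - 1)) * qAux (n - 1) (ℓ + 1) := by
  obtain ⟨M, rfl⟩ : ∃ M, n = M + 2 := ⟨n - 2, by omega⟩
  obtain ⟨c, hc⟩ : (ℓ + 1).factorial ∣ (ℓ + M + 1).factorial :=
    Nat.factorial_dvd_factorial (by omega)
  have h1 : (ℓ + (M + 2) - 1).factorial / ℓ.factorial = c * (ℓ + 1) := by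
    rw [show ℓ + (M + 2) - 1 = ℓ + M + 1 by omega, hc, Nat.factorial_succ]
    exact Nat.div_eq_of_eq_mul_left (Nat.factorial_pos _) (by ring)
  have h2 : (ℓ + 1 + (M + 1) - 1).factorial / (ℓ + 1).factorial = c := by
    rw [show ℓ + 1 + (M + 1) - 1 = ℓ + M + 1 by omega, hc]
    exact Nat.mul_div_cancel_left _ (Nat.factorial_pos _)
  rw [show M + 2 - 1 = M + 1 by omega, qAux, qAux, h1, h2, mul_assoc, mul_left_comm (lcmUpTo _)]
  exact mul_dvd_mul_left c (succ_mul_multinomialLcm_dvd_s4 M ℓ)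
end

section
/- For all integers n ≥ 2 and ℓ ≥ 1, the least common multiple of the products j₁·j₂⋯j_{n-1} taken over all tuples (j₁,…,j_{n-1}) of positive integers satisfying h·j_h ≤ ℓ+n-1 for every h ∈ {1,…,n-1} equals the product ∏_{k=1}^{n-1} lcm(1, 2, …, ⌊(ℓ+n-1)/k⌋). -/
theorem Finset.exists_factorization_lcm_eq {α : Type*} {s : Finset α} (hs : s.Nonempty)
    {f : α → ℕ} (hf : ∀ a ∈ s, f a ≠ 0) (p : ℕ) :
    ∃ a ∈ s, (s.lcm f).factorization p = (f a).factorization p := by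
  classical
  induction hs using Finset.Nonempty.cons_induction with
  | singleton a => exact ⟨a, by simp, by simp⟩
  | cons a s ha hs ih =>
    obtain ⟨b, hb, hbp⟩ := ih fun x hx => hf x (Finset.mem_cons_of_mem hx)
    have h0 : s.lcm f ≠ 0 := fun h => by
      obtain ⟨x, hx, hx0⟩ := Finset.lcm_eq_zero_iff.mp h
      exact hf x (Finset.mem_cons_of_mem hx) hx0
    have key : ((Finset.cons a s ha).lcm f).factorization p =
        max ((f a).factorization p) ((s.lcm f).factorization p) := by
      rw [Finset.cons_eq_insert, Finset.lcm_insert]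
      change (Nat.lcm (f a) (s.lcm f)).factorization p = _
      rw [Nat.factorization_lcm (hf a (Finset.mem_cons_self a s)) h0, Finsupp.sup_apply]
    rcases max_choice ((f a).factorization p) ((s.lcm f).factorization p) with h | h
    · exact ⟨a, Finset.mem_cons_self a s, by rw [key, h]⟩
    · exact ⟨b, Finset.mem_cons_of_mem hb, by rw [key, h, hbp]⟩

theorem prod_lcmUpTo_dvd {ι : Type*} [Fintype ι] {m : ι → ℕ} (hm : ∀ i, 1 ≤ m i) {D : ℕ}
    (hD : D ≠ 0) (h : ∀ j : ι → ℕ, (∀ i, j i ∈ Finset.Icc 1 (m i)) → ∏ i, j i ∣ D) :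
    ∏ i, lcmUpTo (m i) ∣ D := by
  rw [← Nat.factorization_le_iff_dvd
    (Finset.prod_ne_zero_iff.mpr fun i _ => lcmUpTo_ne_zero (m i)) hD]
  intro p
  have hex (i : ι) : ∃ a ∈ Finset.Icc 1 (m i),
      (lcmUpTo (m i)).factorization p = a.factorization p :=
    Finset.exists_factorization_lcm_eq (Finset.nonempty_Icc.mpr (hm i))
      (fun a ha => Nat.one_le_iff_ne_zero.mp (Finset.mem_Icc.mp ha).1) p
  choose j hj hjp using hex
  have hj0 (i : ι) : j i ≠ 0 := Nat.one_le_iff_ne_zero.mp (Finset.mem_Icc.mp (hj i)).1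
  calc (∏ i, lcmUpTo (m i)).factorization p
      = (∏ i, j i).factorization p := by
        rw [Nat.factorization_prod fun i _ => lcmUpTo_ne_zero (m i),
          Nat.factorization_prod fun i _ => hj0 i]
        simp [hjp]
    _ ≤ D.factorization p :=
        (Nat.factorization_le_iff_dvd (Finset.prod_ne_zero_iff.mpr fun i _ => hj0 i) hD).mpr
          (h j hj) p

/-- For all integers `n ≥ 2` and `ℓ ≥ 1`, the least common multiple of the products
`j₁ ⋯ j_{n-1}` over all tuples `(j₁, …, j_{n-1})` of positive integers with
`h·j_h ≤ ℓ+n-1` for every `h ∈ {1, …, n-1}` equals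
`∏_{k=1}^{n-1} lcm(1, 2, …, ⌊(ℓ+n-1)/k⌋)`.
(Here the tuple is encoded as `j : Fin (n-1) → ℕ`, index `h : Fin (n-1)`
corresponding to the integer `h+1 ∈ {1, …, n-1}`.) -/
theorem lcm_prod_eq_prod_lcmUpTo (n ℓ : ℕ) (hn : 2 ≤ n) (hl : 1 ≤ ℓ) :
    ((Fintype.piFinset fun _ : Fin (n - 1) => Finset.Icc 1 (ℓ + n - 1)).filter
        (fun j => ∀ h : Fin (n - 1), ((h : ℕ) + 1) * j h ≤ ℓ + n - 1)).lcm
      (fun j => ∏ h, j h) =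
    ∏ k ∈ Finset.Icc 1 (n - 1), lcmUpTo ((ℓ + n - 1) / k) := by
  have hprod : ∏ k ∈ Finset.Icc 1 (n - 1), lcmUpTo ((ℓ + n - 1) / k) =
      ∏ h : Fin (n - 1), lcmUpTo ((ℓ + n - 1) / ((h : ℕ) + 1)) := by
    rw [Fin.prod_univ_eq_prod_range (fun k => lcmUpTo ((ℓ + n - 1) / (k + 1))),
      Finset.range_eq_Ico, Finset.prod_Ico_add' (fun k => lcmUpTo ((ℓ + n - 1) / k))]
    rfl
  rw [hprod]
  refine Nat.dvd_antisymm (Finset.lcm_dvd fun j hj => ?_) (prod_lcmUpTo_dvd ?_ ?_ ?_)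
  · simp only [Finset.mem_filter, Fintype.mem_piFinset, Finset.mem_Icc] at hj
    refine Finset.prod_dvd_prod_of_dvd _ _ fun h _ => ?_
    refine Finset.dvd_lcm (f := id) (Finset.mem_Icc.mpr ⟨(hj.1 h).1, ?_⟩)
    rw [Nat.le_div_iff_mul_le h.val.succ_pos, mul_comm]
    exact hj.2 h
  · intro h
    rw [Nat.le_div_iff_mul_le h.val.succ_pos]
    omega
  · intro h0
    obtain ⟨j, hj, hj0⟩ := Finset.lcm_eq_zero_iff.mp h0
    obtain ⟨i, -, hi⟩ := Finset.prod_eq_zero_iff.mp hj0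
    simp only [Finset.mem_filter, Fintype.mem_piFinset, Finset.mem_Icc] at hj
    have := (hj.1 i).1
    omega
  · intro j hj
    refine Finset.dvd_lcm (f := fun j : Fin (n - 1) → ℕ => ∏ h, j h) ?_
    simp only [Finset.mem_filter, Fintype.mem_piFinset, Finset.mem_Icc] at hj ⊢
    refine ⟨fun h => ⟨(hj h).1, (hj h).2.trans (Nat.div_le_self _ _)⟩, fun h => ?_⟩
    rw [mul_comm, ← Nat.le_div_iff_mul_le h.val.succ_pos]
    exact (hj h).2
end

section
/- Let n ≥ 1 be an integer and i = (i₁,…,i_n) ∈ ℕⁿ with i₁+⋯+i_n = ℓ. Then the Lebesgue integral over the standard simplex S_n = {(x₁,…,x_n) ∈ ℝⁿ : x_j ≥ 0 for all j and x₁+⋯+x_n ≤ 1} of the monomial x₁^{i₁}⋯x_n^{i_n} equals (i₁!⋯i_n!)/(ℓ+n)!. -/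
open MeasureTheory

/-- The beta integral with natural exponents on the interval `[0, s]`. -/
theorem intervalIntegral_pow_mul_sub_pow (a b : ℕ) (s : ℝ) :
    ∫ t in (0 : ℝ)..s, t ^ a * (s - t) ^ b =
      s ^ (a + b + 1) * (a.factorial * b.factorial / (a + b + 1).factorial) := by
  have antideriv (b : ℕ) (x : ℝ) :
      HasDerivAt (fun t : ℝ ↦ -((s - t) ^ (b + 1) / (b + 1))) ((s - x) ^ b) x := by
    have h := ((((hasDerivAt_id x).const_sub s).pow (b + 1)).div_const ((b : ℝ) + 1)).neg
    have hb : (b : ℝ) + 1 ≠ 0 := by positivity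
    convert! h using 1
    simp only [id, Nat.add_sub_cancel]
    push_cast
    field_simp
  induction a generalizing b with
  | zero =>
    rw [intervalIntegral.integral_eq_sub_of_hasDerivAt
      (f := fun t : ℝ ↦ -((s - t) ^ (b + 1) / (b + 1)))]
    · rw [Nat.zero_add, Nat.factorial_succ]
      have : (b.factorial : ℝ) ≠ 0 := by positivity
      simp
      field_simp
    · intro x _
      simpa using antideriv b x
    · exact Continuous.intervalIntegrable (by fun_prop) _ _
  | succ a ih =>
    rw [intervalIntegral.integral_mul_deriv_eq_deriv_mul
      (u' := fun t ↦ ((a : ℝ) + 1) * t ^ a)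
      (v := fun t : ℝ ↦ -((s - t) ^ (b + 1) / (b + 1)))
      (fun x _ ↦ by simpa using hasDerivAt_pow (a + 1) x) (fun x _ ↦ antideriv b x)
      (Continuous.intervalIntegrable (by fun_prop) _ _)
      (Continuous.intervalIntegrable (by fun_prop) _ _)]
    have h (t : ℝ) : ((a : ℝ) + 1) * t ^ a * -((s - t) ^ (b + 1) / (b + 1)) =
        -(((a : ℝ) + 1) / (b + 1)) * (t ^ a * (s - t) ^ (b + 1)) := by ring
    simp only [h, intervalIntegral.integral_const_mul, ih (b + 1)]
    rw [show a + 1 + b + 1 = a + (b + 1) + 1 by ring, Nat.factorial_succ a, Nat.factorial_succ b]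
    push_cast
    have : (b : ℝ) + 1 ≠ 0 := by positivity
    simp
    field_simp

theorem isCompact_scaled_simplex (n : ℕ) (s : ℝ) :
    IsCompact {x : Fin n → ℝ | (∀ j, 0 ≤ x j) ∧ ∑ j, x j ≤ s} := by
  refine (isCompact_Icc (a := (0 : Fin n → ℝ)) (b := fun _ ↦ s)).of_isClosed_subset ?_ ?_
  · simp only [Set.ofPred_and, Set.ofPred_forall]
    exact (isClosed_iInter fun j ↦ isClosed_le (by fun_prop) (by fun_prop)).inter
      (isClosed_le (by fun_prop) (by fun_prop))
  · rintro x ⟨hx, hs⟩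
    exact ⟨hx, fun j ↦ (Finset.single_le_sum (fun k _ ↦ hx k) (Finset.mem_univ j)).trans hs⟩

/-- The integral of a monomial over the simplex scaled by `s`. -/
theorem integral_scaled_simplex_monomial (n : ℕ) (i : Fin n → ℕ) {s : ℝ} (hs : 0 ≤ s) :
    ∫ x : Fin n → ℝ in {x | (∀ j, 0 ≤ x j) ∧ ∑ j, x j ≤ s}, ∏ j, (x j) ^ (i j) =
      s ^ (∑ j, i j + n) *
        ((∏ j, ((i j).factorial : ℝ)) / ((∑ j, i j + n).factorial : ℝ)) := by
  induction n generalizing s with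
  | zero => simp [hs, Measure.real, volume_pi]
  | succ n ih =>
    have hmeas := (isCompact_scaled_simplex (n + 1) s).measurableSet
    have hint : IntegrableOn (fun x : Fin (n + 1) → ℝ ↦ ∏ j, (x j) ^ (i j))
        {x | (∀ j, 0 ≤ x j) ∧ ∑ j, x j ≤ s} :=
      ContinuousOn.integrableOn_compact (isCompact_scaled_simplex _ s)
        (Continuous.continuousOn (by fun_prop))
    have hsymm := (volume_preserving_piFinSuccAbove (fun _ : Fin (n + 1) ↦ ℝ) 0).symm
    have slice (t : ℝ) (y : Fin n → ℝ) :
        Set.indicator {x : Fin (n + 1) → ℝ | (∀ j, 0 ≤ x j) ∧ ∑ j, x j ≤ s}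
          (fun x ↦ ∏ j, (x j) ^ (i j))
          ((MeasurableEquiv.piFinSuccAbove (fun _ : Fin (n + 1) ↦ ℝ) 0).symm (t, y)) =
        Set.indicator (Set.Icc 0 s) (fun t ↦ t ^ i 0 *
          Set.indicator {x : Fin n → ℝ | (∀ j, 0 ≤ x j) ∧ ∑ j, x j ≤ s - t}
          (fun x ↦ ∏ j, (x j) ^ (i j.succ)) y) t := by
      have hcons : (MeasurableEquiv.piFinSuccAbove (fun _ : Fin (n + 1) ↦ ℝ) 0).symm (t, y) =
          Fin.cons t y := by
        simp [MeasurableEquiv.piFinSuccAbove, Fin.insertNthEquiv]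
      have hmem : (0 ≤ t ∧ ∀ j, 0 ≤ y j) ∧ t + ∑ j, y j ≤ s ↔
          (0 ≤ t ∧ t ≤ s) ∧ (∀ j, 0 ≤ y j) ∧ ∑ j, y j ≤ s - t := by
        constructor
        · rintro ⟨⟨ht, hy⟩, h⟩
          have := Finset.sum_nonneg fun j (_ : j ∈ Finset.univ) ↦ hy j
          exact ⟨⟨ht, by linarith⟩, hy, by linarith⟩
        · rintro ⟨⟨ht, _⟩, hy, h⟩
          exact ⟨⟨ht, hy⟩, by linarith⟩
      rw [hcons]
      simp only [Set.indicator_apply, Set.mem_ofPred_eq, Set.mem_Icc, Fin.forall_fin_succ,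
        Fin.sum_univ_succ, Fin.prod_univ_succ, Fin.cons_zero, Fin.cons_succ, hmem, ite_and,
        mul_ite, mul_zero]
    have hprod := hsymm.integrable_comp_of_integrable (hint.integrable_indicator hmeas)
    simp only [Function.comp_def] at hprod
    rw [← integral_indicator hmeas, ← hsymm.integral_comp', Measure.volume_eq_prod,
      integral_prod _ hprod]
    have inner (t : ℝ) :
        ∫ y : Fin n → ℝ, Set.indicator (Set.Icc 0 s) (fun t ↦ t ^ i 0 *
          Set.indicator {x : Fin n → ℝ | (∀ j, 0 ≤ x j) ∧ ∑ j, x j ≤ s - t}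
          (fun x ↦ ∏ j, (x j) ^ (i j.succ)) y) t =
        Set.indicator (Set.Icc 0 s) (fun t ↦ t ^ i 0 * (s - t) ^ (∑ j : Fin n, i j.succ + n) *
          ((∏ j : Fin n, ((i j.succ).factorial : ℝ)) /
            ((∑ j : Fin n, i j.succ + n).factorial : ℝ))) t := by
      by_cases ht : t ∈ Set.Icc 0 s
      · simp only [Set.indicator_of_mem ht]
        rw [integral_const_mul,
          integral_indicator (isCompact_scaled_simplex n (s - t)).measurableSet,
          ih _ (sub_nonneg.2 ht.2), mul_assoc]
      · simp [Set.indicator_of_notMem ht]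
    simp only [slice, inner]
    rw [integral_indicator measurableSet_Icc, integral_Icc_eq_integral_Ioc,
      ← intervalIntegral.integral_of_le hs, intervalIntegral.integral_mul_const,
      intervalIntegral_pow_mul_sub_pow, Fin.sum_univ_succ, Fin.prod_univ_succ]
    simp only [← add_assoc]
    field_simp

/-- The integral over the standard simplex
`S_n = {x ∈ ℝⁿ : xⱼ ≥ 0, x₁ + ⋯ + xₙ ≤ 1}` of the monomial `x₁^{i₁} ⋯ xₙ^{iₙ}`
equals `(i₁! ⋯ iₙ!)/(ℓ+n)!` where `ℓ = i₁ + ⋯ + iₙ`. -/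
theorem integral_simplex_monomial (n : ℕ) (hn : 1 ≤ n) (i : Fin n → ℕ) (ℓ : ℕ)
    (hi : ∑ j, i j = ℓ) :
    ∫ x : Fin n → ℝ in {x | (∀ j, 0 ≤ x j) ∧ ∑ j, x j ≤ 1}, ∏ j, (x j) ^ (i j) =
      (∏ j, Nat.factorial (i j) : ℕ) / (Nat.factorial (ℓ + n) : ℝ) := by
  subst hi
  simpa using integral_scaled_simplex_monomial n i zero_le_one
end

section
/- Let k be a field, E and F finite-dimensional k-vector spaces, and G a group acting k-linearly on E such that the induced action of G on E ⊗_k k̄ (where k̄ is an algebraic closure of k) is irreducible, i.e. the only G-stable k̄-subspaces of E ⊗_k k̄ are 0 and the whole space. Let G act on E ⊗_k F by g·(x⊗y) = (g·x)⊗y. Then for every G-stable k-subspace W of E ⊗_k F there exists a subspace F₀ of F such that W = E ⊗_k F₀ (the image of E ⊗ F₀ in E ⊗ F). -/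
open TensorProduct

/-- If `1 ⊗ x` vanishes after a field extension then `x` vanishes. -/
theorem eq_zero_of_one_tmul_eq_zero {k K E : Type*} [Field k] [Field K] [Algebra k K]
    [AddCommGroup E] [Module k E] {x : E} (hx : (1 : K) ⊗ₜ[k] x = 0) : x = 0 := by
  refine Module.FaithfullyFlat.tensorProduct_mk_injective (A := k) (B := K) E ?_
  simpa using hx

/-- A stable subspace of a representation that is irreducible over a field extension is trivial. -/
theorem eq_bot_or_eq_top_of_baseChange_irreducible {k K E G : Type*} [Field k] [Field K]
    [Algebra k K] [AddCommGroup E] [Module k E] (ρ : G → Module.End k E)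
    (hirr : ∀ W : Submodule K (K ⊗[k] E),
      (∀ g : G, W.map (LinearMap.baseChange K (ρ g)) ≤ W) → W = ⊥ ∨ W = ⊤)
    (p : Submodule k E) (hp : ∀ g, ∀ x ∈ p, ρ g x ∈ p) : p = ⊥ ∨ p = ⊤ := by
  have hstab : ∀ g : G, (p.baseChange K).map (LinearMap.baseChange K (ρ g)) ≤ p.baseChange K := by
    intro g
    rw [Submodule.map_le_iff_le_comap, Submodule.baseChange_eq_span, Submodule.span_le]
    rintro _ ⟨x, hx, rfl⟩
    exact Submodule.subset_span ⟨ρ g x, hp g x hx, by simp⟩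
  rcases hirr _ hstab with h | h
  · left
    rw [eq_bot_iff]
    intro x hx
    have h1 : (1 : K) ⊗ₜ[k] x ∈ p.baseChange K := Submodule.tmul_mem_baseChange_of_mem 1 hx
    rw [h, Submodule.mem_bot] at h1
    exact eq_zero_of_one_tmul_eq_zero h1
  · right
    rw [eq_top_iff]
    intro x _
    have hle : p.baseChange K ≤ LinearMap.ker (p.mkQ.baseChange K) := by
      rw [Submodule.baseChange_eq_span, Submodule.span_le]
      rintro _ ⟨y, hy, rfl⟩
      simp [(Submodule.Quotient.mk_eq_zero p).2 hy]
    have h1 : (1 : K) ⊗ₜ[k] x ∈ LinearMap.ker (p.mkQ.baseChange K) := hle (h ▸ Submodule.mem_top)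
    rw [LinearMap.mem_ker, LinearMap.baseChange_tmul] at h1
    simpa using eq_zero_of_one_tmul_eq_zero h1

/-- **Schur's lemma** for representations that stay irreducible over an algebraically closed
extension: endomorphisms commuting with the action are scalars of the base field. -/
theorem exists_eq_smul_of_baseChange_irreducible {k K E G : Type*} [Field k] [Field K]
    [IsAlgClosed K] [Algebra k K] [AddCommGroup E] [Module k E] [FiniteDimensional k E]
    (ρ : G → Module.End k E)
    (hirr : ∀ W : Submodule K (K ⊗[k] E),
      (∀ g : G, W.map (LinearMap.baseChange K (ρ g)) ≤ W) → W = ⊥ ∨ W = ⊤)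
    (φ : Module.End k E) (hφ : ∀ g x, φ (ρ g x) = ρ g (φ x)) : ∃ c : k, ∀ x, φ x = c • x := by
  cases subsingleton_or_nontrivial E with
  | inl _ => exact ⟨0, fun x => Subsingleton.elim _ _⟩
  | inr _ =>
    have : Nontrivial (K ⊗[k] E) := by
      obtain ⟨x, hx⟩ := exists_ne (0 : E)
      exact ⟨1 ⊗ₜ x, 0, fun h => hx (eq_zero_of_one_tmul_eq_zero h)⟩
    obtain ⟨μ, hμ⟩ := Module.End.exists_eigenvalue (φ.baseChange K)
    have hcomm (g : G) (y : K ⊗[k] E) :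
        φ.baseChange K ((ρ g).baseChange K y) = (ρ g).baseChange K (φ.baseChange K y) := by
      induction y with
      | zero => simp
      | tmul a x => simp [hφ]
      | add y z hy hz => simp [hy, hz]
    have htop : Module.End.eigenspace (φ.baseChange K) μ = ⊤ := by
      refine (hirr _ ?_).resolve_left hμ
      rintro g _ ⟨y, hy, rfl⟩
      rw [SetLike.mem_coe, Module.End.mem_eigenspace_iff] at hy
      rw [Module.End.mem_eigenspace_iff, hcomm, hy, map_smul]
    have hx (x : E) : (1 : K) ⊗ₜ[k] φ x = μ • ((1 : K) ⊗ₜ[k] x) := by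
      have : (1 : K) ⊗ₜ[k] x ∈ Module.End.eigenspace (φ.baseChange K) μ := htop ▸ Submodule.mem_top
      simpa only [Module.End.mem_eigenspace_iff, LinearMap.baseChange_tmul] using this
    let b := Module.finBasis k E
    let i : Fin (Module.finrank k E) := ⟨0, Module.finrank_pos⟩
    have hc : algebraMap k K (b.repr (φ (b i)) i) = μ := by
      have := congrArg (fun y => (b.baseChange K).repr y i) (hx (b i))
      simpa [Algebra.smul_def] using this
    refine ⟨b.repr (φ (b i)) i, fun x => ?_⟩
    rw [← sub_eq_zero]
    apply eq_zero_of_one_tmul_eq_zero (k := k) (K := K)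
    rw [TensorProduct.tmul_sub, hx, ← hc, TensorProduct.tmul_smul, algebraMap_smul, sub_self]

/-- **Burnside's theorem**: a representation that stays irreducible over an algebraically closed
extension generates the full endomorphism algebra over the base field. -/
theorem adjoin_range_eq_top_of_baseChange_irreducible {k K E G : Type*} [Field k] [Field K]
    [IsAlgClosed K] [Algebra k K] [AddCommGroup E] [Module k E] [FiniteDimensional k E]
    (ρ : G → Module.End k E)
    (hirr : ∀ W : Submodule K (K ⊗[k] E),
      (∀ g : G, W.map (LinearMap.baseChange K (ρ g)) ≤ W) → W = ⊥ ∨ W = ⊤) :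
    Algebra.adjoin k (Set.range ρ) = ⊤ := by
  set A := Algebra.adjoin k (Set.range ρ)
  have hmem (g : G) : ρ g ∈ A := Algebra.subset_adjoin ⟨g, rfl⟩
  have hss : IsSemisimpleModule A E := by
    cases subsingleton_or_nontrivial E with
    | inl _ => infer_instance
    | inr _ =>
      have : IsSimpleModule A E :=
        { eq_bot_or_eq_top := fun p => by
            rcases eq_bot_or_eq_top_of_baseChange_irreducible ρ hirr (p.restrictScalars k)
              (fun g x hx => p.smul_mem ⟨ρ g, hmem g⟩ hx) with h | h
            · exact Or.inl (by simpa using h)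
            · exact Or.inr (by simpa using h) }
      infer_instance
  rw [eq_top_iff]
  intro T _
  let f : Module.End (Module.End A E) E :=
    { toFun := T
      map_add' := map_add T
      map_smul' := fun φ x => by
        obtain ⟨c, hc⟩ := exists_eq_smul_of_baseChange_irreducible ρ hirr (φ.restrictScalars k)
          (fun g y => φ.map_smul ⟨ρ g, hmem g⟩ y)
        have hc' (y : E) : φ y = c • y := hc y
        simp [hc'] }
  classical
  let b := Module.finBasis k E
  obtain ⟨r, hr⟩ := jacobson_density f (Finset.univ.image b)
  have hT : T = r := b.ext fun i => hr (b i) (by simp)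
  exact hT ▸ r.2

/-- A subspace of `E ⊗ F` stable under `End E` acting on the first factor has the form `E ⊗ F₀`. -/
theorem exists_eq_range_map_id_subtype_of_forall_end {k E F : Type*} [Field k]
    [AddCommGroup E] [Module k E] [FiniteDimensional k E] [AddCommGroup F] [Module k F]
    (W : Submodule k (E ⊗[k] F)) (hW : ∀ T : Module.End k E, ∀ w ∈ W, T.rTensor F w ∈ W) :
    ∃ F₀ : Submodule k F,
      W = LinearMap.range (TensorProduct.map (LinearMap.id : E →ₗ[k] E) F₀.subtype) := by
  let F₀ : Submodule k F := ⨅ e : E, W.comap (TensorProduct.mk k E F e)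
  have hF₀ (f : F) : f ∈ F₀ ↔ ∀ e : E, e ⊗ₜ[k] f ∈ W := by simp [F₀]
  refine ⟨F₀, le_antisymm (fun w hw => ?_) ?_⟩
  · let b := Module.finBasis k E
    obtain ⟨c, rfl⟩ : ∃ c : Fin (Module.finrank k E) → F, w = ∑ i, b i ⊗ₜ[k] c i := by
      obtain ⟨c, hc⟩ := TensorProduct.eq_repr_basis_left b w
      exact ⟨c, by rw [← hc, Finsupp.sum_fintype _ _ (by simp)]⟩
    have hc (i) : c i ∈ F₀ := by
      rw [hF₀]
      intro e
      have := hW ((b.coord i).smulRight e) _ hw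
      simpa [Finsupp.single_apply, ite_smul, TensorProduct.ite_tmul] using this
    exact Submodule.sum_mem _ fun i _ => ⟨b i ⊗ₜ ⟨c i, hc i⟩, by simp⟩
  · rintro _ ⟨y, rfl⟩
    induction y with
    | zero => simp
    | tmul e f => simpa using (hF₀ f).1 f.2 e
    | add y z hy hz => simpa using W.add_mem hy hz

/-- Let `k` be a field, `E` and `F` finite-dimensional `k`-vector spaces and `G` a
group acting `k`-linearly on `E` such that the induced action on
`E ⊗_k k̄` is irreducible (only `G`-stable subspaces are `0` and everything), where
`k̄` is an algebraic closure of `k`.  Let `G` act on `E ⊗_k F` through the first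
factor.  Then every `G`-stable subspace `W` of `E ⊗_k F` has the form `E ⊗ F₀`
for some subspace `F₀` of `F`. -/
theorem stable_subspace_of_tensor_eq_tensor_of_subspace
    {k : Type*} [Field k] {E F : Type*}
    [AddCommGroup E] [Module k E] [FiniteDimensional k E]
    [AddCommGroup F] [Module k F] [FiniteDimensional k F]
    {G : Type*} [Group G] (ρ : Representation k G E)
    (hirr : ∀ W : Submodule (AlgebraicClosure k) ((AlgebraicClosure k) ⊗[k] E),
      (∀ g : G, W.map (LinearMap.baseChange (AlgebraicClosure k) (ρ g)) ≤ W) →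
      W = ⊥ ∨ W = ⊤)
    (W : Submodule k (E ⊗[k] F))
    (hW : ∀ g : G, W.map (TensorProduct.map (ρ g) (LinearMap.id : F →ₗ[k] F)) ≤ W) :
    ∃ F₀ : Submodule k F,
      W = LinearMap.range (TensorProduct.map (LinearMap.id : E →ₗ[k] E) F₀.subtype) := by
  refine exists_eq_range_map_id_subtype_of_forall_end W fun T => ?_
  have hT : T ∈ Algebra.adjoin k (Set.range ρ) := by
    rw [adjoin_range_eq_top_of_baseChange_irreducible (K := AlgebraicClosure k) ρ hirr]
    exact Algebra.mem_top
  induction hT using Algebra.adjoin_induction with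
  | mem x hx =>
    obtain ⟨g, rfl⟩ := hx
    exact fun w hw => hW g ⟨w, hw, rfl⟩
  | algebraMap c =>
    intro w hw
    rw [Algebra.algebraMap_eq_smul_one, LinearMap.rTensor_smul, Module.End.one_eq_id,
      LinearMap.rTensor_id]
    exact W.smul_mem c hw
  | add x y _ _ hx hy =>
    intro w hw
    rw [LinearMap.rTensor_add]
    exact W.add_mem (hx w hw) (hy w hw)
  | mul x y _ _ hx hy =>
    intro w hw
    rw [LinearMap.rTensor_mul]
    exact hx _ (hy w hw)
end

section
/- Let n ≥ 1 and ℓ ≥ 1 be integers and set λ = ⌊ℓ/n⌋. Then the minimum of i₁!·i₂!⋯i_n! over all tuples (i₁,…,i_n) ∈ ℕⁿ with i₁+⋯+i_n = ℓ equals (λ!)ⁿ·(λ+1)^{ℓ-nλ}; equivalently, the maximum of the multinomial coefficients ℓ!/(i₁!⋯i_n!) over such tuples equals ℓ!/((λ!)ⁿ·(λ+1)^{ℓ-nλ}). -/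
open Nat in
/-- A tangent-line inequality expressing the log-convexity of the factorial. -/
theorem Nat.factorial_mul_succ_pow_le (a k : ℕ) :
    a ! * (a + 1) ^ k ≤ k ! * (a + 1) ^ a := by
  rcases le_total a k with h | h
  · obtain ⟨d, rfl⟩ := Nat.exists_eq_add_of_le h
    rw [pow_add, mul_left_comm, mul_comm ((a + d)!)]
    exact Nat.mul_le_mul_left _ Nat.factorial_mul_pow_le_factorial
  · obtain ⟨d, rfl⟩ := Nat.exists_eq_add_of_le h
    rw [← Nat.factorial_mul_ascFactorial, pow_add, mul_assoc, mul_comm _ ((k + d + 1) ^ d)]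
    gcongr
    exact (Nat.ascFactorial_le_pow_add k d).trans (Nat.pow_le_pow_left (Nat.le_succ _) d)

open Nat in
theorem Finset.factorial_pow_card_mul_pow_le_prod_factorial {ι : Type*} (s : Finset ι)
    (f : ι → ℕ) {a r : ℕ} (h : ∑ j ∈ s, f j = s.card * a + r) :
    a ! ^ s.card * (a + 1) ^ r ≤ ∏ j ∈ s, (f j)! := by
  have key : ∏ j ∈ s, (a ! * (a + 1) ^ f j) ≤ ∏ j ∈ s, ((f j)! * (a + 1) ^ a) :=
    Finset.prod_le_prod' fun j _ => Nat.factorial_mul_succ_pow_le a (f j)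
  rw [Finset.prod_mul_distrib, Finset.prod_mul_distrib, Finset.prod_pow_eq_pow_sum, h,
    Finset.prod_const, Finset.prod_const, ← pow_mul, mul_comm a s.card, pow_add,
    mul_left_comm, mul_comm (∏ j ∈ s, (f j)!)] at key
  exact Nat.le_of_mul_le_mul_left key (by positivity)

open Nat in
theorem Fin.exists_sum_eq_and_prod_factorial_eq {n r : ℕ} (a : ℕ) (hr : r ≤ n) :
    ∃ f : Fin n → ℕ, ∑ j, f j = n * a + r ∧ ∏ j, (f j)! = a ! ^ n * (a + 1) ^ r := by
  have hcard : (Finset.univ.filter fun j : Fin n => (j : ℕ) < r).card = r := by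
    rw [Fin.card_filter_val_lt, min_eq_right hr]
  refine ⟨fun j => a + if (j : ℕ) < r then 1 else 0, ?_, ?_⟩
  · rw [Finset.sum_add_distrib, Finset.sum_boole, hcard]
    simp
  · have hfac (j : Fin n) : (a + if (j : ℕ) < r then 1 else 0)! =
        a ! * if (j : ℕ) < r then a + 1 else 1 := by
      split_ifs
      · rw [Nat.factorial_succ, mul_comm]
      · simp
    simp_rw [hfac]
    rw [Finset.prod_mul_distrib, Finset.prod_ite, Finset.prod_const, Finset.prod_const, hcard]
    simp

/-- Let `n ≥ 1`, `ℓ ≥ 1` and `λ = ⌊ℓ/n⌋`.  The minimum of `i₁! ⋯ iₙ!` over all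
tuples `(i₁, …, iₙ) ∈ ℕⁿ` with `i₁ + ⋯ + iₙ = ℓ` equals `(λ!)ⁿ · (λ+1)^{ℓ-nλ}`;
equivalently, the maximum of the multinomial coefficients `ℓ!/(i₁! ⋯ iₙ!)` over
such tuples equals `ℓ!/((λ!)ⁿ · (λ+1)^{ℓ-nλ})`. -/
theorem isLeast_prod_factorial (n ℓ : ℕ) (hn : 1 ≤ n) (hl : 1 ≤ ℓ) :
    IsLeast ((fun i : Fin n → ℕ => ∏ j, Nat.factorial (i j)) ''
        {i : Fin n → ℕ | ∑ j, i j = ℓ})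
      (Nat.factorial (ℓ / n) ^ n * (ℓ / n + 1) ^ (ℓ - n * (ℓ / n))) ∧
    IsGreatest ((fun i : Fin n → ℕ => Nat.multinomial Finset.univ i) ''
        {i : Fin n → ℕ | ∑ j, i j = ℓ})
      (Nat.factorial ℓ / (Nat.factorial (ℓ / n) ^ n * (ℓ / n + 1) ^ (ℓ - n * (ℓ / n)))) := by
  have hdiv : n * (ℓ / n) + (ℓ - n * (ℓ / n)) = ℓ := Nat.add_sub_of_le (Nat.mul_div_le ℓ n)
  have hr : ℓ - n * (ℓ / n) ≤ n := by
    have := Nat.mod_lt ℓ hn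
    have := Nat.div_add_mod ℓ n
    omega
  have hle (f : Fin n → ℕ) (hf : ∑ j, f j = ℓ) :
      Nat.factorial (ℓ / n) ^ n * (ℓ / n + 1) ^ (ℓ - n * (ℓ / n)) ≤
        ∏ j, Nat.factorial (f j) := by
    simpa using Finset.univ.factorial_pow_card_mul_pow_le_prod_factorial f
      (a := ℓ / n) (r := ℓ - n * (ℓ / n)) (by rw [hf, Finset.card_fin, hdiv])
  obtain ⟨g, hg, hprod⟩ := Fin.exists_sum_eq_and_prod_factorial_eq (ℓ / n) hr
  rw [hdiv] at hg
  refine ⟨⟨⟨g, hg, hprod⟩, ?_⟩, ⟨g, hg, ?_⟩, ?_⟩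
  · rintro _ ⟨f, hf, rfl⟩
    exact hle f hf
  · simp only [Nat.multinomial, hg, hprod]
  · rintro _ ⟨f, hf, rfl⟩
    simp only [Nat.multinomial, show ∑ j, f j = ℓ from hf]
    exact Nat.div_le_div_left (hle f hf) (by positivity)
end

section
/- For all integers n ≥ 1 and ℓ ≥ 1, one has n^ℓ ≤ C(ℓ+n-1, n-1) · p(n,ℓ), where C(ℓ+n-1, n-1) is the binomial coefficient; equivalently, p(n,ℓ) ≥ n^ℓ / C(ℓ+n-1, n-1). -/
theorem multinomial_le_multinomialLcm {n ℓ : ℕ} {i : Fin n → ℕ}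
    (hi : i ∈ Finset.Nat.antidiagonalTuple n ℓ) :
    Nat.multinomial Finset.univ i ≤ multinomialLcm n ℓ := by
  refine Nat.le_of_dvd (Nat.pos_of_ne_zero ?_) (Finset.dvd_lcm hi)
  rw [multinomialLcm, Ne, Finset.lcm_eq_zero_iff]
  rintro ⟨j, -, hj⟩
  exact (Nat.multinomial_pos Finset.univ j).ne' hj

theorem card_antidiagonalTuple_eq_multichoose (n ℓ : ℕ) :
    (Finset.Nat.antidiagonalTuple n ℓ).card = n.multichoose ℓ := by
  rw [← Finset.piAntidiag_univ_fin_eq_antidiagonalTuple, ← Finset.map_sym_eq_piAntidiag,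
    Finset.card_map, Finset.sym_univ, Finset.card_univ, Sym.card_sym_eq_multichoose,
    Fintype.card_fin]

/-- For all integers `n ≥ 1` and `ℓ ≥ 1`,
`n^ℓ ≤ C(ℓ+n-1, n-1) · p(n,ℓ)`. -/
theorem pow_le_choose_mul_multinomialLcm (n ℓ : ℕ) (hn : 1 ≤ n) (hl : 1 ≤ ℓ) :
    n ^ ℓ ≤ Nat.choose (ℓ + n - 1) (n - 1) * multinomialLcm n ℓ := by
  have card_eq : (Finset.Nat.antidiagonalTuple n ℓ).card = Nat.choose (ℓ + n - 1) (n - 1) := by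
    rw [card_antidiagonalTuple_eq_multichoose, Nat.multichoose_eq, add_comm n ℓ]
    exact Nat.choose_symm_of_eq_add (by omega)
  have pow_eq : n ^ ℓ =
      ∑ i ∈ Finset.Nat.antidiagonalTuple n ℓ, Nat.multinomial Finset.univ i := by
    simpa [Finset.piAntidiag_univ_fin_eq_antidiagonalTuple] using
      Finset.sum_pow_eq_sum_piAntidiag (Finset.univ : Finset (Fin n)) (fun _ => (1 : ℕ)) ℓ
  rw [pow_eq, ← card_eq, ← smul_eq_mul]
  exact Finset.sum_le_card_nsmul _ _ _ fun i hi => multinomial_le_multinomialLcm hi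
end

section
/- For all integers n ≥ 1 and ℓ ≥ 1, one has log p(n,ℓ) ≤ (3/2)·ℓ·log n; equivalently, p(n,ℓ)² ≤ n^{3ℓ}. -/
/-- Starting from `L = lcmUpto n`, walk through `lcmUpto (n + 1), …, lcmUpto (n + 2 ^ j)` while
checking `(lcmUpto m) ^ 2 ≤ 2 ^ (3 * m)`; returns the last value, or `0` if a check fails. -/
def lcmUptoScan : ℕ → ℕ → ℕ → ℕ
  | 0, n, L =>
    bif Nat.ble (L * ((n + 1) / Nat.gcd (L % (n + 1)) (n + 1))) (2 ^ (3 * (n + 1) / 2)) ||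
      Nat.ble ((L * ((n + 1) / Nat.gcd (L % (n + 1)) (n + 1))) ^ 2) (2 ^ (3 * (n + 1)))
    then L * ((n + 1) / Nat.gcd (L % (n + 1)) (n + 1)) else 0
  | j + 1, n, L =>
    match lcmUptoScan j n L with
    | 0 => 0
    | M + 1 => lcmUptoScan j (n + 2 ^ j) (M + 1)

theorem Nat.lcmUpto_succ (n : ℕ) :
    Nat.lcmUpto (n + 1) =
      Nat.lcmUpto n * ((n + 1) / Nat.gcd (Nat.lcmUpto n % (n + 1)) (n + 1)) := by
  have h : Finset.Icc 1 (n + 1) = insert (n + 1) (Finset.Icc 1 n) := by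
    ext; simp; omega
  rw [Nat.lcmUpto, h, Finset.lcm_insert, ← Nat.lcmUpto, id, ← Nat.gcd_rec, Nat.gcd_comm (n + 1),
    ← Nat.mul_div_assoc _ (Nat.gcd_dvd_right _ _)]
  exact Nat.lcm_comm _ _

theorem lcmUptoScan_spec (j n : ℕ) (h : lcmUptoScan j n (Nat.lcmUpto n) ≠ 0) :
    lcmUptoScan j n (Nat.lcmUpto n) = Nat.lcmUpto (n + 2 ^ j) ∧
      ∀ m, n < m → m ≤ n + 2 ^ j → Nat.lcmUpto m ^ 2 ≤ 2 ^ (3 * m) := by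
  induction j generalizing n with
  | zero =>
    simp only [lcmUptoScan, ← Nat.lcmUpto_succ] at h ⊢
    cases hb : (Nat.ble (Nat.lcmUpto (n + 1)) (2 ^ (3 * (n + 1) / 2)) ||
      Nat.ble (Nat.lcmUpto (n + 1) ^ 2) (2 ^ (3 * (n + 1)))) with
    | false => simp [hb] at h
    | true =>
      refine ⟨by simp, fun m h1 h2 => ?_⟩
      obtain rfl : m = n + 1 := by simp at h2; omega
      simp only [Bool.or_eq_true, Nat.ble_eq] at hb
      rcases hb with hb | hb
      · calc _ ≤ (2 ^ (3 * (n + 1) / 2)) ^ 2 := Nat.pow_le_pow_left hb 2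
          _ = 2 ^ (3 * (n + 1) / 2 * 2) := (pow_mul _ _ _).symm
          _ ≤ _ := Nat.pow_le_pow_right (by norm_num) (Nat.div_mul_le_self _ _)
      · exact hb
  | succ j ih =>
    have hstep : lcmUptoScan j n (Nat.lcmUpto n) ≠ 0 := by
      intro h0
      simp [lcmUptoScan, h0] at h
    obtain ⟨h1, h2⟩ := ih n hstep
    have hscan : lcmUptoScan (j + 1) n (Nat.lcmUpto n) =
        lcmUptoScan j (n + 2 ^ j) (Nat.lcmUpto (n + 2 ^ j)) := by
      obtain ⟨M, hM⟩ := Nat.exists_eq_succ_of_ne_zero (Nat.lcmUpto_ne_zero (n + 2 ^ j))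
      rw [lcmUptoScan, h1, hM]
    rw [hscan] at h ⊢
    obtain ⟨h3, h4⟩ := ih _ h
    have hp : n + 2 ^ j + 2 ^ j = n + 2 ^ (j + 1) := by ring
    rw [hp] at h3 h4
    refine ⟨h3, fun m hm1 hm2 => ?_⟩
    rcases le_or_gt m (n + 2 ^ j) with hm | hm
    · exact h2 m hm1 hm
    · exact h4 m hm hm2

theorem Nat.sq_lcmUpto_le_of_le {m : ℕ} (hm : m ≤ 65536) : Nat.lcmUpto m ^ 2 ≤ 2 ^ (3 * m) := by
  have h : lcmUptoScan 16 0 (Nat.lcmUpto 0) ≠ 0 := by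
    have h0 : Nat.lcmUpto 0 = 1 := rfl
    rw [h0]
    decide +kernel
  rcases Nat.eq_zero_or_pos m with rfl | h0
  · simp [Nat.lcmUpto]
  · exact (lcmUptoScan_spec 16 0 h).2 m h0 (by simpa using hm)

theorem Nat.sum_div_le_sum_div_add {ι : Type*} (s : Finset ι) (f : ι → ℕ) {q : ℕ} (hq : 0 < q) :
    (∑ j ∈ s, f j) / q ≤ ∑ j ∈ s, f j / q + (s.card - 1) := by
  rcases s.eq_empty_or_nonempty with rfl | hs
  · simp
  have h1 : ∑ j ∈ s, f j ≤ ∑ j ∈ s, (q * (f j / q) + (q - 1)) :=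
    Finset.sum_le_sum fun j _ => by
      have := Nat.div_add_mod (f j) q
      have := Nat.mod_lt (f j) hq
      omega
  rw [Finset.sum_add_distrib, ← Finset.mul_sum, Finset.sum_const, smul_eq_mul] at h1
  obtain ⟨k, hk⟩ := Nat.exists_eq_succ_of_ne_zero hs.card_ne_zero
  obtain ⟨r, rfl⟩ := Nat.exists_eq_succ_of_ne_zero hq.ne'
  rw [hk] at h1 ⊢
  rw [← Nat.lt_succ_iff, Nat.div_lt_iff_lt_mul hq]
  simp only [Nat.succ_eq_add_one, Nat.add_sub_cancel] at h1 ⊢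
  nlinarith

/-- Counting the pairs `(m, k)` with `1 ≤ m ≤ n` and `p ^ k ≤ ℓ / m` in two ways. -/
theorem Nat.sum_log_div {p : ℕ} (hp : 1 < p) (n ℓ : ℕ) :
    ∑ m ∈ Finset.Icc 1 n, Nat.log p (ℓ / m) =
      ∑ k ∈ Finset.Ico 1 (ℓ + 1), min n (ℓ / p ^ k) := by
  have hpos : ∀ k, 0 < p ^ k := fun k => pow_pos (by omega) k
  calc _ = ∑ m ∈ Finset.Icc 1 n, ∑ k ∈ Finset.Ico 1 (ℓ + 1), if m ≤ ℓ / p ^ k then 1 else 0 := by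
        refine Finset.sum_congr rfl fun m hm => ?_
        have hm0 : 0 < m := by simp at hm; omega
        rw [← Finset.card_filter]
        have : (Finset.Ico 1 (ℓ + 1)).filter (fun k => m ≤ ℓ / p ^ k) =
            Finset.Icc 1 (Nat.log p (ℓ / m)) := by
          ext k
          simp only [Finset.mem_filter, Finset.mem_Ico, Finset.mem_Icc]
          constructor
          · rintro ⟨⟨h1, h2⟩, h3⟩
            refine ⟨h1, Nat.le_log_of_pow_le hp ?_⟩
            rw [Nat.le_div_iff_mul_le (hpos k)] at h3
            rw [Nat.le_div_iff_mul_le hm0]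
            linarith
          · rintro ⟨h1, h2⟩
            have h0 : ℓ / m ≠ 0 := by
              intro h0
              rw [h0, Nat.log_zero_right] at h2
              omega
            have h3 := Nat.pow_le_of_le_log h0 h2
            have h4 := (Nat.lt_pow_self hp (n := k)).trans_le h3
            have h5 := Nat.div_le_self ℓ m
            refine ⟨⟨h1, by omega⟩, ?_⟩
            rw [Nat.le_div_iff_mul_le hm0] at h3
            rw [Nat.le_div_iff_mul_le (hpos k)]
            linarith
        rw [this, Nat.card_Icc, Nat.add_sub_cancel]
    _ = _ := by
        rw [Finset.sum_comm]
        refine Finset.sum_congr rfl fun k _ => ?_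
        rw [← Finset.card_filter]
        have : (Finset.Icc 1 n).filter (fun m => m ≤ ℓ / p ^ k) =
            Finset.Icc 1 (min n (ℓ / p ^ k)) := by
          ext; simp; omega
        rw [this, Nat.card_Icc, Nat.add_sub_cancel]

theorem Nat.multinomial_dvd_prod_lcmUpto {ι : Type*} (s : Finset ι) (f : ι → ℕ) :
    Nat.multinomial s f ∣ ∏ m ∈ Finset.Icc 1 (s.card - 1), Nat.lcmUpto ((∑ j ∈ s, f j) / m) := by
  set ℓ := ∑ j ∈ s, f j with hℓ
  have hprod : ∏ m ∈ Finset.Icc 1 (s.card - 1), Nat.lcmUpto (ℓ / m) ≠ 0 :=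
    Finset.prod_ne_zero_iff.2 fun _ _ => Nat.lcmUpto_ne_zero _
  rw [← Nat.factorization_prime_le_iff_dvd (Nat.multinomial_pos _ _).ne' hprod]
  intro p hp
  rw [Nat.factorization_prod fun _ _ => Nat.lcmUpto_ne_zero _, Finsupp.finsetSum_apply]
  simp only [Nat.factorization_lcmUpto _ hp]
  rw [Nat.sum_log_div hp.one_lt]
  have hspec := congrArg (fun t => t.factorization p) (Nat.multinomial_spec s f)
  have hfac : ∏ i ∈ s, (f i).factorial ≠ 0 :=
    Finset.prod_ne_zero_iff.2 fun _ _ => Nat.factorial_ne_zero _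
  have hlog : ∀ i, i ≤ ℓ → Nat.log p i < ℓ + 1 := fun i hi =>
    Nat.lt_succ_of_le ((Nat.log_le_self p i).trans hi)
  simp only [Nat.factorization_mul hfac (Nat.multinomial_pos _ _).ne', Finsupp.add_apply] at hspec
  rw [Nat.factorization_prod fun _ _ => Nat.factorial_ne_zero _, Finsupp.finsetSum_apply,
    Nat.factorization_factorial hp (hlog ℓ le_rfl), Finset.sum_congr rfl fun i hi =>
      Nat.factorization_factorial hp
        (hlog (f i) (Finset.single_le_sum (fun _ _ => Nat.zero_le _) hi)),
    Finset.sum_comm] at hspec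
  have hmain : ∑ k ∈ Finset.Ico 1 (ℓ + 1), ℓ / p ^ k ≤
      ∑ k ∈ Finset.Ico 1 (ℓ + 1), (∑ i ∈ s, f i / p ^ k + min (s.card - 1) (ℓ / p ^ k)) := by
    refine Finset.sum_le_sum fun k _ => ?_
    have := Nat.sum_div_le_sum_div_add s f (pow_pos hp.pos k)
    rw [← hℓ] at this
    omega
  rw [Finset.sum_add_distrib] at hmain
  omega

theorem multinomialLcm_dvd_prod_lcmUpto (n ℓ : ℕ) :
    multinomialLcm n ℓ ∣ ∏ m ∈ Finset.Icc 1 (n - 1), Nat.lcmUpto (ℓ / m) := by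
  refine Finset.lcm_dvd fun i hi => ?_
  have h := Nat.multinomial_dvd_prod_lcmUpto Finset.univ i
  rwa [Finset.Nat.mem_antidiagonalTuple.1 hi, Finset.card_univ, Fintype.card_fin] at h

/-- The harmonic number `H n` is at most `log₂ (n + 1)`. -/
theorem sum_inv_mul_log_two_le (n : ℕ) :
    (∑ m ∈ Finset.Icc 1 n, (m : ℝ)⁻¹) * Real.log 2 ≤ Real.log (n + 1) := by
  induction n with
  | zero => simp
  | succ n ih =>
    rw [Finset.sum_Icc_succ_top (by omega), add_mul]
    have hn : (0 : ℝ) < n + 1 := by positivity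
    have h : ((n + 1 : ℕ) : ℝ)⁻¹ * Real.log 2 ≤ Real.log (n + 1 + 1) - Real.log (n + 1) := by
      have h0 : (-1 : ℝ) ≤ 1 / (n + 1) := le_trans (by norm_num) (by positivity : (0 : ℝ) ≤ _)
      have hb := one_add_mul_self_le_rpow_one_add h0 (p := (n : ℝ) + 1) (by simp)
      have h1 : 1 + 1 / ((n : ℝ) + 1) = (n + 1 + 1) / (n + 1) := by field_simp
      rw [mul_one_div_cancel hn.ne', one_add_one_eq_two, ← Real.log_le_log_iff (by norm_num)
        (by positivity), Real.log_rpow (by positivity), h1] at hb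
      rwa [← Real.log_div (by positivity) hn.ne', Nat.cast_succ, inv_mul_le_iff₀ hn]
    push_cast at h ⊢
    linarith

theorem log_multinomialLcm_le_of_log_lcmUpto_le
    (H : ∀ m : ℕ, Real.log (Nat.lcmUpto m) ≤ 3 / 2 * Real.log 2 * m) (n ℓ : ℕ) (hn : 1 ≤ n) :
    Real.log (multinomialLcm n ℓ) ≤ (3 / 2 : ℝ) * ℓ * Real.log n := by
  have hprod : 0 < ∏ m ∈ Finset.Icc 1 (n - 1), Nat.lcmUpto (ℓ / m) :=
    Finset.prod_pos fun _ _ => Nat.lcmUpto_pos _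
  have hdvd := multinomialLcm_dvd_prod_lcmUpto n ℓ
  have hlog2 : 0 ≤ Real.log 2 := Real.log_nonneg (by norm_num)
  calc Real.log (multinomialLcm n ℓ)
      ≤ Real.log (∏ m ∈ Finset.Icc 1 (n - 1), Nat.lcmUpto (ℓ / m) : ℕ) :=
        Real.log_le_log (by exact_mod_cast Nat.pos_of_dvd_of_pos hdvd hprod)
          (by exact_mod_cast Nat.le_of_dvd hprod hdvd)
    _ = ∑ m ∈ Finset.Icc 1 (n - 1), Real.log (Nat.lcmUpto (ℓ / m)) := by
        rw [Nat.cast_prod, Real.log_prod fun m _ => by exact_mod_cast Nat.lcmUpto_ne_zero _]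
    _ ≤ ∑ m ∈ Finset.Icc 1 (n - 1), 3 / 2 * Real.log 2 * (ℓ * (m : ℝ)⁻¹) := by
        refine Finset.sum_le_sum fun m _ => (H _).trans ?_
        gcongr
        exact Nat.cast_div_le
    _ = 3 / 2 * ℓ * ((∑ m ∈ Finset.Icc 1 (n - 1), (m : ℝ)⁻¹) * Real.log 2) := by
        rw [← Finset.mul_sum, ← Finset.mul_sum]; ring
    _ ≤ 3 / 2 * ℓ * Real.log n := by
        have h := sum_inv_mul_log_two_le (n - 1)
        rw [Nat.cast_sub hn, Nat.cast_one, sub_add_cancel] at h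
        gcongr

/-- The sum `∑ b * f a` over the pairs `(a, b)` of a list. -/
def List.weightedSum {R : Type*} [Semiring R] (l : List (ℕ × ℕ)) (f : ℕ → R) : R :=
  (l.map fun t => (t.2 : R) * f t.1).sum

namespace List

section Semiring

variable {R : Type*} [Semiring R]

theorem weightedSum_cons (t : ℕ × ℕ) (l : List (ℕ × ℕ)) (f : ℕ → R) :
    weightedSum (t :: l) f = t.2 * f t.1 + weightedSum l f := by
  simp [weightedSum]

theorem weightedSum_add (l : List (ℕ × ℕ)) (f g : ℕ → R) :
    weightedSum l (fun a => f a + g a) = weightedSum l f + weightedSum l g := by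
  simp [weightedSum, mul_add, List.sum_map_add]

theorem weightedSum_mul_const (l : List (ℕ × ℕ)) (f : ℕ → R) (c : R) :
    weightedSum l (fun a => f a * c) = weightedSum l f * c := by
  simp [weightedSum, ← mul_assoc, List.sum_map_mul_right]

theorem map_weightedSum {S : Type*} [Semiring S] (φ : R →+* S) (l : List (ℕ × ℕ)) (f : ℕ → R) :
    φ (weightedSum l f) = weightedSum l fun a => φ (f a) := by
  simp [weightedSum, map_list_sum, Function.comp_def]

end Semiring

variable {l : List (ℕ × ℕ)}

theorem weightedSum_congr {R : Type*} [Semiring R] {f g : ℕ → R} (h : ∀ t ∈ l, f t.1 = g t.1) :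
    weightedSum l f = weightedSum l g := by
  unfold weightedSum
  rw [List.map_congr_left fun t ht => by rw [h t ht]]

theorem weightedSum_le_weightedSum {f g : ℕ → ℝ} (h : ∀ t ∈ l, f t.1 ≤ g t.1) :
    weightedSum l f ≤ weightedSum l g :=
  List.sum_le_sum fun t ht => mul_le_mul_of_nonneg_left (h t ht) (Nat.cast_nonneg _)

theorem weightedSum_finsetSum {ι : Type*} (s : Finset ι) (c : ι → ℝ) (f : ι → ℕ → ℝ) :
    weightedSum l (fun a => ∑ i ∈ s, c i * f i a) = ∑ i ∈ s, c i * weightedSum l (f i) := by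
  induction l with
  | nil => simp [weightedSum]
  | cons t l ih =>
    simp only [weightedSum_cons, ih, mul_add, Finset.sum_add_distrib, Finset.mul_sum]
    congr 1
    exact Finset.sum_congr rfl fun i _ => by ring

end List

section Stirling

open Real

theorem mul_log_sub_self_mono {a b : ℝ} (ha : 1 ≤ a) (hab : a ≤ b) :
    a * log a - a ≤ b * log b - b := by
  have ha0 : 0 < a := by linarith
  have hb0 : 0 < b := by linarith
  have h := one_sub_inv_le_log_of_pos (div_pos hb0 ha0)
  rw [log_div hb0.ne' ha0.ne', inv_div] at h
  have h1 : b * (1 - a / b) ≤ b * (log b - log a) := mul_le_mul_of_nonneg_left h hb0.le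
  have h2 : b * (1 - a / b) = b - a := by field_simp
  have h3 : a * log a ≤ b * log a := mul_le_mul_of_nonneg_right hab (log_nonneg ha)
  linarith

theorem log_factorial_le {n : ℕ} (hn : 1 ≤ n) :
    log n.factorial ≤ n * log n - n + log n / 2 + 1 := by
  obtain ⟨m, rfl⟩ := Nat.exists_eq_add_of_le' hn
  have h : Stirling.stirlingSeq (m + 1) ≤ Stirling.stirlingSeq 1 :=
    Stirling.stirlingSeq'_antitone (Nat.zero_le m)
  have h1 := log_le_log (Stirling.stirlingSeq'_pos m) h
  rw [Stirling.log_stirlingSeq_formula, Stirling.log_stirlingSeq_formula] at h1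
  have hm : (0 : ℝ) < (m + 1 : ℕ) := by positivity
  rw [log_mul two_ne_zero hm.ne', log_div hm.ne' (exp_pos 1).ne', log_exp] at h1
  simp at h1
  push_cast at h1 ⊢
  nlinarith

theorem abs_log_factorial_div_sub_le {N d : ℕ} (hd : 0 < d) (hdN : d ≤ N) :
    |log (N / d).factorial - (N / d * log (N / d) - N / d : ℝ)| ≤ log N / 2 + 1 := by
  set n := N / d with hn
  have hd0 : (0 : ℝ) < d := by exact_mod_cast hd
  have hn1 : 1 ≤ n := (Nat.one_le_div_iff hd).2 hdN
  have hn1' : (1 : ℝ) ≤ n := by exact_mod_cast hn1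
  have hny : (n : ℝ) ≤ N / d := Nat.cast_div_le
  have hyn : (N / d : ℝ) ≤ n + 1 := by
    rw [div_le_iff₀ hd0]
    exact_mod_cast (Nat.lt_mul_of_div_lt (Nat.lt_succ_self n) hd).le
  have hnN : (n : ℝ) ≤ N := by exact_mod_cast Nat.div_le_self N d
  have hlog : log n ≤ log N := log_le_log (by linarith) hnN
  have hlog' : log (n + 1) ≤ log 2 + log N := by
    rw [← log_mul two_ne_zero (by linarith)]
    exact log_le_log (by linarith) (by linarith)
  rw [abs_le]
  constructor
  · have h1 := mul_log_sub_self_mono (hn1'.trans hny) hyn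
    have h2 := Stirling.le_log_factorial_stirling (Nat.succ_ne_zero n)
    have h4 : log (n + 1).factorial = log (n + 1) + log n.factorial := by
      rw [Nat.factorial_succ, Nat.cast_mul, log_mul (by positivity) (by positivity), Nat.cast_succ]
    rw [Nat.succ_eq_add_one, h4, Nat.cast_succ] at h2
    have h3 : 0 ≤ log (2 * π) := log_nonneg (by linarith [pi_gt_three])
    linarith [log_two_lt_d9]
  · have h1 := mul_log_sub_self_mono hn1' hny
    have h2 := log_factorial_le hn1
    linarith

end Stirling

section Chebyshev

open ArithmeticFunction
open scoped Chebyshev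

theorem Nat.log_factorial_div_eq_sum (N d : ℕ) :
    Real.log (N / d).factorial = ∑ n ∈ Finset.Icc 1 N, Λ n * ((N / n / d : ℕ) : ℝ) := by
  have key : ∀ M : ℕ, Real.log M.factorial = ∑ n ∈ Finset.Icc 1 M, Λ n * ((M / n : ℕ) : ℝ) := by
    intro M
    induction M with
    | zero => simp
    | succ M ih =>
      rw [Nat.factorial_succ, Nat.cast_mul, Real.log_mul (by positivity) (by positivity), ih,
        ← vonMangoldt_sum]
      have h1 : ∑ n ∈ Finset.Icc 1 M, Λ n * ((M / n : ℕ) : ℝ) =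
          ∑ n ∈ Finset.Icc 1 (M + 1), Λ n * ((M / n : ℕ) : ℝ) := by
        rw [Finset.sum_Icc_succ_top (by omega), Nat.div_eq_of_lt (Nat.lt_succ_self M)]
        simp
      have h2 : ∑ n ∈ (M + 1).divisors, Λ n =
          ∑ n ∈ Finset.Icc 1 (M + 1), Λ n * (if n ∣ M + 1 then 1 else 0) := by
        simp only [mul_ite, mul_one, mul_zero, ← Finset.sum_filter]
        refine Finset.sum_congr ?_ fun _ _ => rfl
        ext n
        simp only [Nat.mem_divisors, Finset.mem_filter, Finset.mem_Icc]
        constructor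
        · rintro ⟨h, h'⟩
          exact ⟨⟨Nat.pos_of_dvd_of_pos h (by omega), Nat.le_of_dvd (by omega) h⟩, h⟩
        · rintro ⟨_, h⟩
          exact ⟨h, by omega⟩
      rw [h1, h2, ← Finset.sum_add_distrib]
      refine Finset.sum_congr rfl fun n _ => ?_
      rw [← mul_add, Nat.succ_div]
      push_cast
      ring
  rw [key]
  refine Finset.sum_subset_zero_on_sdiff
    (Finset.Icc_subset_Icc_right (Nat.div_le_self _ _)) (fun n hn => ?_) fun n _ => ?_
  · simp only [Finset.mem_sdiff, Finset.mem_Icc, not_and, not_le] at hn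
    rw [Nat.div_div_eq_div_mul, mul_comm n, ← Nat.div_div_eq_div_mul,
      Nat.div_eq_of_lt (hn.2 hn.1.1)]
    simp
  · rw [Nat.div_div_eq_div_mul, Nat.div_div_eq_div_mul, mul_comm d]

theorem Chebyshev.psi_div_eq_sum {N k : ℕ} (hk : 0 < k) :
    ψ ((N / k : ℕ) : ℝ) = ∑ n ∈ Finset.Icc 1 N, Λ n * (if k ≤ N / n then 1 else 0) := by
  rw [Chebyshev.psi, Nat.floor_natCast]
  simp only [mul_ite, mul_one, mul_zero, ← Finset.sum_filter]
  refine Finset.sum_congr ?_ fun _ _ => rfl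
  ext n
  simp only [Finset.mem_Ioc, Finset.mem_filter, Finset.mem_Icc]
  have hle := Nat.div_le_self N k
  constructor
  · rintro ⟨h1, h2⟩
    refine ⟨⟨h1, h2.trans hle⟩, ?_⟩
    rw [Nat.le_div_iff_mul_le hk] at h2
    rw [Nat.le_div_iff_mul_le h1]
    linarith
  · rintro ⟨⟨h1, _⟩, h2⟩
    rw [Nat.le_div_iff_mul_le h1] at h2
    refine ⟨h1, ?_⟩
    rw [Nat.le_div_iff_mul_le hk]
    linarith

end Chebyshev

section Certificate

open ArithmeticFunction
open scoped Chebyshev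

variable {pos neg step : List (ℕ × ℕ)} {Q Y : ℕ}

/-- The real-valued form of a floor inequality that is checked for `y < Y`. Adding the
(nonnegative) multiple `e * y` turns the combination of floor functions into a bounded one, so the
total weight of `step` takes care of all `y ≥ Y`. -/
theorem List.weightedSum_div_le
    (hpos : ∀ t ∈ pos, 0 < t.1) (hstep : ∀ t ∈ step, t.1 ≤ Y)
    (hfloor : ∀ y < Y, 1 ≤ y → Q + neg.weightedSum (fun a => y / a) ≤
      pos.weightedSum (fun a => y / a) + step.weightedSum (fun a => if a ≤ y then 1 else 0))
    (htotal : Q + pos.weightedSum (fun a => 1 - (a : ℝ)⁻¹) ≤ step.weightedSum fun _ => 1)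
    {e : ℝ} (he : pos.weightedSum (fun a => (a : ℝ)⁻¹) + e = neg.weightedSum fun a => (a : ℝ)⁻¹)
    (he0 : 0 ≤ e) {y : ℕ} (hy : 1 ≤ y) :
    Q + neg.weightedSum (fun a => ((y / a : ℕ) : ℝ)) ≤
      pos.weightedSum (fun a => ((y / a : ℕ) : ℝ)) + e * y +
        step.weightedSum (fun a => if a ≤ y then 1 else 0) := by
  rcases lt_or_ge y Y with hyY | hyY
  · have h := (Nat.cast_le (α := ℝ)).2 (hfloor y hyY hy)
    push_cast [← Nat.coe_castRingHom, List.map_weightedSum] at h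
    simp only [Nat.coe_castRingHom, Nat.cast_ite, Nat.cast_one, Nat.cast_zero] at h
    have : 0 ≤ e * y := by positivity
    linarith
  · have h1 : neg.weightedSum (fun a => ((y / a : ℕ) : ℝ)) ≤
        neg.weightedSum (fun a => (a : ℝ)⁻¹) * y := by
      rw [← List.weightedSum_mul_const]
      refine List.weightedSum_le_weightedSum fun t _ => Nat.cast_div_le.trans_eq ?_
      ring
    have h2 : pos.weightedSum (fun a => (a : ℝ)⁻¹) * y ≤
        pos.weightedSum (fun a => ((y / a : ℕ) : ℝ)) +
          pos.weightedSum (fun a => 1 - (a : ℝ)⁻¹) := by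
      rw [← List.weightedSum_mul_const, ← List.weightedSum_add]
      refine List.weightedSum_le_weightedSum fun t ht => ?_
      have h0 : (0 : ℝ) < t.1 := by exact_mod_cast hpos t ht
      have h3 : y + 1 ≤ (y / t.1) * t.1 + t.1 := by
        have := Nat.lt_mul_of_div_lt (Nat.lt_succ_self (y / t.1)) (hpos t ht)
        rw [Nat.succ_eq_add_one] at this
        nlinarith
      have h4 : (y + 1 : ℝ) ≤ ((y / t.1 : ℕ) : ℝ) * t.1 + t.1 := by exact_mod_cast h3
      rw [← mul_le_mul_iff_left₀ h0]
      field_simp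
      linarith
    have h3 : step.weightedSum (fun _ => (1 : ℝ)) =
        step.weightedSum (fun a => if a ≤ y then 1 else 0) :=
      List.weightedSum_congr fun t ht => by rw [if_pos ((hstep t ht).trans hyY)]
    have h4 : neg.weightedSum (fun a => (a : ℝ)⁻¹) * y =
        pos.weightedSum (fun a => (a : ℝ)⁻¹) * y + e * y := by rw [← he]; ring
    linarith

theorem Chebyshev.mul_psi_add_le {e : ℝ} (hstep : ∀ t ∈ step, 0 < t.1)
    (h : ∀ y : ℕ, 1 ≤ y → Q + neg.weightedSum (fun a => ((y / a : ℕ) : ℝ)) ≤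
      pos.weightedSum (fun a => ((y / a : ℕ) : ℝ)) + e * y +
        step.weightedSum (fun a => if a ≤ y then 1 else 0)) (N : ℕ) :
    Q * ψ N + neg.weightedSum (fun a => Real.log (N / a).factorial) ≤
      pos.weightedSum (fun a => Real.log (N / a).factorial) + e * Real.log N.factorial +
        step.weightedSum (fun a => ψ ((N / a : ℕ) : ℝ)) := by
  have h1 : step.weightedSum (fun a => ψ ((N / a : ℕ) : ℝ)) = step.weightedSum
      (fun a => ∑ n ∈ Finset.Icc 1 N, Λ n * (if a ≤ N / n then 1 else 0)) :=
    List.weightedSum_congr fun t ht => Chebyshev.psi_div_eq_sum (hstep t ht)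
  have h2 := Chebyshev.psi_div_eq_sum (N := N) one_pos
  have h3 := Nat.log_factorial_div_eq_sum N 1
  rw [Nat.div_one] at h2 h3
  rw [h1, h2, h3]
  simp only [Nat.log_factorial_div_eq_sum, List.weightedSum_finsetSum]
  rw [Finset.mul_sum, Finset.mul_sum, ← Finset.sum_add_distrib, ← Finset.sum_add_distrib,
    ← Finset.sum_add_distrib]
  refine Finset.sum_le_sum fun n hn => ?_
  rw [Finset.mem_Icc] at hn
  have hy : 1 ≤ N / n := (Nat.one_le_div_iff hn.1).2 hn.2
  have := mul_le_mul_of_nonneg_left (h (N / n) hy) (vonMangoldt_nonneg (n := n))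
  rw [if_pos hy, Nat.div_one]
  linarith

/-- Replacing the logarithms of factorials by their main terms. -/
theorem Chebyshev.mul_psi_le {e : ℝ} (he0 : 0 ≤ e)
    (he : pos.weightedSum (fun a => (a : ℝ)⁻¹) + e = neg.weightedSum fun a => (a : ℝ)⁻¹)
    {N : ℕ} (hN : 1 ≤ N) (hpos : ∀ t ∈ pos, 0 < t.1 ∧ t.1 ≤ N)
    (hneg : ∀ t ∈ neg, 0 < t.1 ∧ t.1 ≤ N)
    (h : Q * ψ N + neg.weightedSum (fun a => Real.log (N / a).factorial) ≤
      pos.weightedSum (fun a => Real.log (N / a).factorial) + e * Real.log N.factorial +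
        step.weightedSum (fun a => ψ ((N / a : ℕ) : ℝ))) :
    Q * ψ N ≤ (neg.weightedSum (fun a => (a : ℝ)⁻¹ * Real.log a) -
        pos.weightedSum (fun a => (a : ℝ)⁻¹ * Real.log a)) * N +
      (pos.weightedSum (fun _ => 1) + neg.weightedSum (fun _ => 1) + e) * (Real.log N / 2 + 1) +
      step.weightedSum (fun a => ψ ((N / a : ℕ) : ℝ)) := by
  have hN0 : (N : ℝ) ≠ 0 := by positivity
  have main : ∀ a : ℕ, 0 < a → (N / a * Real.log (N / a) - N / a : ℝ) =
      (a : ℝ)⁻¹ * (N * Real.log N - N) + -((a : ℝ)⁻¹ * Real.log a * N) := by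
    intro a ha
    rw [Real.log_div hN0 (by positivity)]
    ring
  have hp : pos.weightedSum (fun a => Real.log (N / a).factorial) ≤
      pos.weightedSum (fun a => (a : ℝ)⁻¹ * (N * Real.log N - N) +
        (a : ℝ)⁻¹ * Real.log a * -N + 1 * (Real.log N / 2 + 1)) := by
    refine List.weightedSum_le_weightedSum fun t ht => ?_
    have h1 := (abs_le.1 (abs_log_factorial_div_sub_le (hpos t ht).1 (hpos t ht).2)).2
    rw [main _ (hpos t ht).1] at h1
    linarith
  have hn : neg.weightedSum (fun a => (a : ℝ)⁻¹ * (N * Real.log N - N) +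
        (a : ℝ)⁻¹ * Real.log a * -N + 1 * -(Real.log N / 2 + 1)) ≤
      neg.weightedSum (fun a => Real.log (N / a).factorial) := by
    refine List.weightedSum_le_weightedSum fun t ht => ?_
    have h1 := (abs_le.1 (abs_log_factorial_div_sub_le (hneg t ht).1 (hneg t ht).2)).1
    rw [main _ (hneg t ht).1] at h1
    linarith
  have h1 : e * Real.log N.factorial ≤ e * (N * Real.log N - N + (Real.log N / 2 + 1)) := by
    refine mul_le_mul_of_nonneg_left ?_ he0
    linarith [log_factorial_le hN]
  rw [List.weightedSum_add, List.weightedSum_add, List.weightedSum_mul_const,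
    List.weightedSum_mul_const, List.weightedSum_mul_const] at hp hn
  rw [← he] at hn
  linarith

end Certificate

section LogBounds

theorem Nat.log2_pow_div_mul_log_two_le {d k : ℕ} (hd : 0 < d) (hk : 0 < k) :
    ((Nat.log2 (d ^ k) : ℝ) / k) * Real.log 2 ≤ Real.log d := by
  have h := (Nat.cast_le (α := ℝ)).2 (Nat.log2_self_le (pow_pos hd k).ne')
  push_cast at h
  have h1 := Real.log_le_log (by positivity) h
  rw [Real.log_pow, Real.log_pow] at h1
  rw [div_mul_eq_mul_div, div_le_iff₀ (by positivity)]
  linarith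

theorem Nat.log_le_log2_pow_succ_div_mul_log_two {d k : ℕ} (hd : 0 < d) (hk : 0 < k) :
    Real.log d ≤ ((Nat.log2 (d ^ k) + 1 : ℝ) / k) * Real.log 2 := by
  have h := (Nat.cast_le (α := ℝ)).2 (Nat.lt_log2_self (n := d ^ k)).le
  push_cast at h
  have h1 := Real.log_le_log (by positivity) h
  rw [Real.log_pow, Real.log_pow] at h1
  rw [div_mul_eq_mul_div, le_div_iff₀ (by positivity)]
  push_cast at h1
  linarith

end LogBounds

section LcmUptoBound

open scoped Chebyshev

/-- The positive coefficients `b` of `log (N / a)!`, listed as pairs `(a, b)`. -/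
def posCoeffs : List (ℕ × ℕ) :=
  [(1, 4), (6, 4), (10, 4), (14, 4), (15, 4), (21, 4), (22, 4), (26, 4), (33, 2), (34, 3),
   (38, 2), (39, 4), (46, 3), (50, 1), (55, 1), (57, 3), (58, 2), (65, 1), (70, 1), (73, 1),
   (74, 1), (82, 2), (85, 1), (86, 3), (90, 2), (92, 1), (93, 2), (95, 2), (96, 1)]

/-- The absolute values `b` of the negative coefficients of `log (N / a)!`, as pairs `(a, b)`. -/
def negCoeffs : List (ℕ × ℕ) :=
  [(2, 4), (3, 4), (5, 4), (7, 4), (11, 4), (13, 4), (17, 4), (19, 4), (23, 3), (24, 1), (29, 3),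
   (30, 5), (31, 1), (37, 2), (41, 4), (42, 4), (43, 3), (45, 1), (53, 1), (59, 1), (60, 2),
   (66, 1), (68, 1), (76, 1), (78, 5), (84, 1), (97, 1), (99, 1), (100, 1)]

/-- The coefficients `b` of `ψ (N / a)`, listed as pairs `(a, b)`. -/
def stepCoeffs : List (ℕ × ℕ) :=
  [(35, 4), (57, 1), (58, 1), (87, 1), (221, 2), (222, 1), (725, 1), (1276, 1), (1599, 1),
   (2832, 1), (4000, 55)]

theorem floor_inequality_of_lt : ∀ y < 4000, 1 ≤ y →
    4 + negCoeffs.weightedSum (fun a => y / a) ≤ posCoeffs.weightedSum (fun a => y / a) +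
      stepCoeffs.weightedSum (fun a => if a ≤ y then 1 else 0) := by
  have h : ∀ i < 40, ∀ j < 100, 1 ≤ 100 * i + j →
      4 + negCoeffs.weightedSum (fun a => (100 * i + j) / a) ≤
        posCoeffs.weightedSum (fun a => (100 * i + j) / a) +
          stepCoeffs.weightedSum (fun a => if a ≤ 100 * i + j then 1 else 0) := by
    decide +kernel
  intro y hy
  have hy' := h (y / 100) (by omega) (y % 100) (Nat.mod_lt _ (by norm_num))
  rwa [Nat.div_add_mod] at hy'

/-- The defect of `∑ b / a` over all coefficients from being zero. -/
def coeffDefect : ℚ :=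
  negCoeffs.weightedSum (fun a => (a : ℚ)⁻¹) - posCoeffs.weightedSum (fun a => (a : ℚ)⁻¹)

theorem coeffDefect_nonneg : 0 ≤ coeffDefect := by
  decide +kernel

theorem total_step_weight : 4 + posCoeffs.weightedSum (fun a => 1 - (a : ℚ)⁻¹) ≤
    stepCoeffs.weightedSum fun _ => 1 := by
  decide +kernel

theorem main_term_bound :
    negCoeffs.weightedSum (fun a => (a : ℚ)⁻¹ * ((Nat.log2 (a ^ 1000) + 1) / 1000)) -
      posCoeffs.weightedSum (fun a => (a : ℚ)⁻¹ * (Nat.log2 (a ^ 1000) / 1000)) +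
      (posCoeffs.weightedSum (fun _ => 1) + negCoeffs.weightedSum (fun _ => 1) + coeffDefect) *
        (945 / 100 / 65536) + stepCoeffs.weightedSum (fun a => (a : ℚ)⁻¹) * (3 / 2) ≤ 6 := by
  decide +kernel

theorem Real.log_div_two_add_one_le {x : ℝ} (hx : 65536 ≤ x) :
    Real.log x / 2 + 1 ≤ 945 / 100 / 65536 * (Real.log 2 * x) := by
  have h1 := Real.log_le_sub_one_of_pos (show 0 < x / 65536 by positivity)
  have h2 : Real.log 65536 = 16 * Real.log 2 := by
    rw [show (65536 : ℝ) = 2 ^ 16 by norm_num, Real.log_pow]; norm_num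
  rw [Real.log_div (by positivity) (by norm_num), h2] at h1
  nlinarith [Real.log_two_gt_d9]

theorem Chebyshev.mul_psi_le_of_large {N : ℕ} (hN : 65536 ≤ N)
    (ih : ∀ m < N, ψ m ≤ 3 / 2 * Real.log 2 * m) : 4 * ψ N ≤ 6 * (Real.log 2 * N) := by
  have hpos : ∀ t ∈ posCoeffs, 0 < t.1 ∧ t.1 ≤ 100 := by decide
  have hneg : ∀ t ∈ negCoeffs, 0 < t.1 ∧ t.1 ≤ 100 := by decide
  have hstep : ∀ t ∈ stepCoeffs, 1 < t.1 ∧ t.1 ≤ 4000 := by decide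
  have hL : 0 < Real.log 2 := Real.log_pos one_lt_two
  have hdef : ((coeffDefect : ℚ) : ℝ) =
      negCoeffs.weightedSum (fun a => (a : ℝ)⁻¹) - posCoeffs.weightedSum fun a => (a : ℝ)⁻¹ := by
    rw [coeffDefect, Rat.cast_sub]
    simp only [← Rat.coe_castHom, List.map_weightedSum, map_inv₀, map_natCast]
  have hdef' : posCoeffs.weightedSum (fun a => (a : ℝ)⁻¹) + (coeffDefect : ℚ) =
      negCoeffs.weightedSum fun a => (a : ℝ)⁻¹ := by
    rw [hdef]; ring
  have hdef0 : (0 : ℝ) ≤ (coeffDefect : ℚ) := Rat.cast_nonneg.2 coeffDefect_nonneg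
  have htotal := (Rat.cast_le (K := ℝ)).2 total_step_weight
  simp only [← Rat.coe_castHom, List.map_weightedSum, map_inv₀, map_natCast, map_add, map_sub,
    map_one, map_ofNat] at htotal
  have hbound := (Rat.cast_le (K := ℝ)).2 main_term_bound
  simp only [← Rat.coe_castHom, List.map_weightedSum, map_inv₀, map_natCast, map_add, map_sub,
    map_mul, map_div₀, map_one, map_ofNat] at hbound
  rw [Rat.coe_castHom] at hbound
  have h := Chebyshev.mul_psi_le (Q := 4) hdef0 hdef' (by omega)
    (fun t ht => ⟨(hpos t ht).1, (hpos t ht).2.trans (by omega)⟩)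
    (fun t ht => ⟨(hneg t ht).1, (hneg t ht).2.trans (by omega)⟩)
    (Chebyshev.mul_psi_add_le (fun t ht => one_pos.trans (hstep t ht).1)
      (fun y hy => List.weightedSum_div_le (fun t ht => (hpos t ht).1)
        (fun t ht => (hstep t ht).2) floor_inequality_of_lt (by exact_mod_cast htotal)
        hdef' hdef0 hy) N)
  have hlogneg : negCoeffs.weightedSum (fun a => (a : ℝ)⁻¹ * Real.log a) ≤
      negCoeffs.weightedSum (fun a => (a : ℝ)⁻¹ * ((Nat.log2 (a ^ 1000) + 1) / 1000)) *
        Real.log 2 := by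
    rw [← List.weightedSum_mul_const]
    refine List.weightedSum_le_weightedSum fun t ht => ?_
    rw [mul_assoc]
    gcongr
    exact_mod_cast Nat.log_le_log2_pow_succ_div_mul_log_two (hneg t ht).1 (k := 1000) (by norm_num)
  have hlogpos : posCoeffs.weightedSum (fun a => (a : ℝ)⁻¹ * (Nat.log2 (a ^ 1000) / 1000)) *
        Real.log 2 ≤ posCoeffs.weightedSum (fun a => (a : ℝ)⁻¹ * Real.log a) := by
    rw [← List.weightedSum_mul_const]
    refine List.weightedSum_le_weightedSum fun t ht => ?_
    rw [mul_assoc]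
    gcongr
    exact_mod_cast Nat.log2_pow_div_mul_log_two_le (hpos t ht).1 (k := 1000) (by norm_num)
  have hpsi : stepCoeffs.weightedSum (fun a => ψ ((N / a : ℕ) : ℝ)) ≤
      stepCoeffs.weightedSum (fun a => (a : ℝ)⁻¹) * (3 / 2 * Real.log 2 * N) := by
    rw [← List.weightedSum_mul_const]
    refine List.weightedSum_le_weightedSum fun t ht => ?_
    refine (ih _ (Nat.div_lt_self (by omega) (hstep t ht).1)).trans ?_
    have h1 : ((N / t.1 : ℕ) : ℝ) ≤ (t.1 : ℝ)⁻¹ * N :=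
      Nat.cast_div_le.trans_eq (div_eq_inv_mul _ _)
    calc _ ≤ 3 / 2 * Real.log 2 * ((t.1 : ℝ)⁻¹ * N) := by gcongr
      _ = _ := by ring
  have hsize : 0 ≤ posCoeffs.weightedSum (fun _ => (1 : ℝ)) +
      negCoeffs.weightedSum (fun _ => (1 : ℝ)) + (coeffDefect : ℚ) := by
    have h0 : ∀ l : List (ℕ × ℕ), 0 ≤ l.weightedSum fun _ => (1 : ℝ) := fun l => by
      simp [List.weightedSum, ← Nat.cast_list_sum, ← Function.comp_def, ← List.map_map]
    linarith [h0 posCoeffs, h0 negCoeffs]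
  have hlogN := mul_le_mul_of_nonneg_left
    (Real.log_div_two_add_one_le (x := N) (by exact_mod_cast hN)) hsize
  have hN0 : (0 : ℝ) ≤ N := N.cast_nonneg
  have hmain := mul_le_mul_of_nonneg_right (sub_le_sub hlogneg hlogpos) hN0
  have hfinal := mul_le_mul_of_nonneg_right hbound (mul_nonneg hL.le hN0)
  push_cast at h
  linarith

/-- The bound `ψ(N) ≤ (3/2) · log 2 · N`. -/
theorem Nat.log_lcmUpto_le (N : ℕ) : Real.log (Nat.lcmUpto N) ≤ 3 / 2 * Real.log 2 * N := by
  induction N using Nat.strong_induction_on with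
  | _ N ih =>
    rcases le_total N 65536 with hN | hN
    · have h := (Nat.cast_le (α := ℝ)).2 (Nat.sq_lcmUpto_le_of_le hN)
      push_cast at h
      have hpos : (0 : ℝ) < Nat.lcmUpto N := by exact_mod_cast Nat.lcmUpto_pos N
      have h1 := Real.log_le_log (by positivity) h
      rw [Real.log_pow, Real.log_pow] at h1
      push_cast at h1
      linarith
    · have h := Chebyshev.mul_psi_le_of_large hN fun m hm => by
        rw [Chebyshev.psi_eq_log_lcmUpto]; exact ih m hm
      rw [Chebyshev.psi_eq_log_lcmUpto] at h
      linarith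

end LcmUptoBound

/-- For all integers `n ≥ 1` and `ℓ ≥ 1`, `log p(n,ℓ) ≤ (3/2)·ℓ·log n`. -/
theorem log_multinomialLcm_le (n ℓ : ℕ) (hn : 1 ≤ n) (hl : 1 ≤ ℓ) :
    Real.log (multinomialLcm n ℓ) ≤ (3 / 2 : ℝ) * ℓ * Real.log n := by
  exact log_multinomialLcm_le_of_log_lcmUpto_le Nat.log_lcmUpto_le n ℓ hn
end

section
/- Let a and b be positive integers and let z be a complex number with z^b = (2+i)^a, where i is the imaginary unit. Then the complex number 2/z is not integral over ℤ (i.e. 2/z is not an algebraic integer). -/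
open Complex

lemma isIntegral_I : IsIntegral ℤ I :=
  IsIntegral.of_pow (n := 2) two_pos (by rw [I_sq]; exact isIntegral_one.neg)

/-- No power of `2` is divisible by `2 + i` among the algebraic integers. -/
lemma not_isIntegral_two_pow_div (b : ℕ) : ¬ IsIntegral ℤ ((2 : ℂ) ^ b / (2 + I)) := by
  intro h
  have hconj := h.map (starRingEnd ℂ).toIntAlgHom
  have hprod := h.mul hconj
  have hnorm : (2 + I) * (2 - I) = 5 := by
    linear_combination -I_sq
  have heq : (2 : ℂ) ^ b / (2 + I) * (starRingEnd ℂ).toIntAlgHom ((2 : ℂ) ^ b / (2 + I)) =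
      algebraMap ℚ ℂ (4 ^ b / 5) := by
    have hc : (starRingEnd ℂ) ((2 : ℂ) ^ b / (2 + I)) = 2 ^ b / (2 - I) := by
      simp [sub_eq_add_neg, map_ofNat (starRingEnd ℂ) 2]
    change _ * (starRingEnd ℂ) ((2 : ℂ) ^ b / (2 + I)) = _
    rw [hc, div_mul_div_comm, hnorm, ← mul_pow]
    norm_num
  rw [heq, isIntegral_algebraMap_iff (algebraMap ℚ ℂ).injective,
    IsIntegrallyClosed.isIntegral_iff] at hprod
  obtain ⟨n, hn⟩ := hprod
  have hn' : (4 : ℤ) ^ b = 5 * n := by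
    have : (n : ℚ) = 4 ^ b / 5 := by simpa using hn
    field_simp at this
    exact_mod_cast (by linarith : (4 : ℚ) ^ b = 5 * n)
  have h5 : Prime (5 : ℤ) := by norm_num
  have : (5 : ℤ) ∣ 4 := h5.dvd_of_dvd_pow ⟨n, hn'⟩
  omega

/-- Let `a, b` be positive integers and `z ∈ ℂ` with `z^b = (2+i)^a`.
Then `2/z` is not an algebraic integer. -/
theorem not_isIntegral_two_div (a b : ℕ) (ha : 0 < a) (hb : 0 < b)
    (z : ℂ) (hz : z ^ b = (2 + I) ^ a) :
    ¬ IsIntegral ℤ (2 / z) := by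
  intro h
  have hne : (2 + I : ℂ) ≠ 0 := fun h0 => by simpa using congrArg im h0
  have h2 : IsIntegral ℤ (2 + I) :=
    (isIntegral_algebraMap (R := ℤ) (A := ℂ) (x := 2)).add isIntegral_I
  obtain ⟨k, rfl⟩ := Nat.exists_eq_add_of_lt ha
  have heq : (2 / z) ^ b * (2 + I) ^ k = 2 ^ b / (2 + I) := by
    rw [div_pow, hz, zero_add, pow_succ]
    field_simp
  exact not_isIntegral_two_pow_div b (heq ▸ (h.pow b).mul (h2.pow k))
end

section
/- Let a and b be positive integers, let z and w be complex numbers with z^b = (2+i)^a and w^b = (2-i)^a, and let ξ be a root of unity in ℂ. Then it is not the case that both (1+ξ)/z and (1−ξ)/w are algebraic integers (integral over ℤ). -/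
open Complex

theorem IsIntegral.complex_conj {x : ℂ} (hx : IsIntegral ℤ x) :
    IsIntegral ℤ ((starRingEnd ℂ) x) :=
  hx.map (starRingEnd ℂ).toIntAlgHom

theorem IsIntegral.of_pow_eq_one {R A : Type*} [CommRing R] [Ring A] [Algebra R A] {x : A} {n : ℕ}
    (hn : 0 < n) (hx : x ^ n = 1) : IsIntegral R x :=
  IsIntegral.of_pow hn (hx ▸ isIntegral_one)

theorem Int.dvd_of_isIntegral_div {m n : ℤ} (hn : n ≠ 0)
    (h : IsIntegral ℤ ((m : ℂ) / n)) : n ∣ m := by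
  have h' : IsIntegral ℤ ((m : ℚ) / n) := by
    rw [← isIntegral_algebraMap_iff (algebraMap ℚ ℂ).injective]
    simpa using h
  obtain ⟨k, hk⟩ := IsIntegrallyClosed.isIntegral_iff.mp h'
  have hn' : (n : ℚ) ≠ 0 := by exact_mod_cast hn
  rw [eq_intCast, eq_div_iff hn'] at hk
  refine ⟨k, ?_⟩
  have : k * n = m := by exact_mod_cast hk
  rw [← this, mul_comm]

/-- Let `a, b` be positive integers, `z, w ∈ ℂ` with `z^b = (2+i)^a` and
`w^b = (2-i)^a`, and let `ξ` be a root of unity.  Then `(1+ξ)/z` and `(1−ξ)/w`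
are not both algebraic integers. -/
theorem not_isIntegral_both (a b : ℕ) (ha : 0 < a) (hb : 0 < b)
    (z w : ℂ) (hz : z ^ b = (2 + I) ^ a) (hw : w ^ b = (2 - I) ^ a)
    (ξ : ℂ) (hξ : ∃ m : ℕ, 0 < m ∧ ξ ^ m = 1) :
    ¬ (IsIntegral ℤ ((1 + ξ) / z) ∧ IsIntegral ℤ ((1 - ξ) / w)) := by
  rintro ⟨h₁, h₂⟩
  obtain ⟨m, hm, hξm⟩ := hξ
  have hI : (2 - I : ℂ) ≠ 0 := fun h => by simpa using congrArg Complex.im h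
  have hw0 : w ≠ 0 := by
    rintro rfl
    rw [zero_pow hb.ne'] at hw
    exact pow_ne_zero a hI hw.symm
  have hconj : (starRingEnd ℂ) z ^ b = w ^ b := by
    rw [← map_pow, hz, hw, map_pow]
    simp [sub_eq_add_neg, Complex.conj_ofNat]
  have hz0 : (starRingEnd ℂ) z ≠ 0 := by
    intro h
    rw [h, zero_pow hb.ne'] at hconj
    exact pow_ne_zero b hw0 hconj.symm
  have hξξ : ξ * (starRingEnd ℂ) ξ = 1 := by
    rw [Complex.mul_conj, Complex.normSq_eq_norm_sq,
      Complex.norm_eq_one_of_pow_eq_one hξm hm.ne']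
    simp
  have hζ : IsIntegral ℤ ((starRingEnd ℂ) z / w) :=
    .of_pow_eq_one hb (by rw [div_pow, hconj, div_self (pow_ne_zero b hw0)])
  -- Conjugation turns divisibility of `1 + ξ` by `z` into divisibility by `w`.
  have h₃ : IsIntegral ℤ ((1 + ξ) / w) := by
    have h := ((IsIntegral.of_pow_eq_one hm hξm).mul h₁.complex_conj).mul hζ
    refine (congrArg (IsIntegral ℤ) ?_).mp h
    rw [map_div₀, map_add, map_one]
    field_simp
    linear_combination hξξ
  have h₄ : IsIntegral ℤ (2 / w) := by
    refine (congrArg (IsIntegral ℤ) ?_).mp (h₃.add h₂)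
    ring
  have h₅ : IsIntegral ℤ (((4 ^ b : ℤ) : ℂ) / (5 ^ a : ℤ)) := by
    refine (congrArg (IsIntegral ℤ) ?_).mp ((h₄.mul h₄.complex_conj).pow b)
    rw [map_div₀, mul_pow, div_pow, div_pow, ← map_pow _ w, hw, map_pow, div_mul_div_comm,
      ← mul_pow, ← mul_pow]
    have h5 : (2 - I) * (starRingEnd ℂ) (2 - I) = 5 := by
      rw [Complex.mul_conj]
      norm_num [Complex.normSq_apply]
    rw [h5, Complex.conj_ofNat]
    norm_num
  have h₆ : (5 : ℤ) ∣ 4 ^ b :=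
    (dvd_pow_self 5 ha.ne').trans (Int.dvd_of_isIntegral_div (by positivity) h₅)
  have h₇ : (5 : ℤ) ∣ 4 := (by norm_num : Prime (5 : ℤ)).dvd_of_dvd_pow h₆
  norm_num at h₇
end

section
/- Let K be a field of characteristic zero, n ≥ 1 and 1 ≤ ℓ ≤ n integers, and E a finite-dimensional K-vector space. Let A_n ⊆ K^{n+1} be the hyperplane {(x₁,…,x_{n+1}) : x₁+⋯+x_{n+1} = 0}. Write a nonzero element x of (⋀^ℓ A_n) ⊗ E ⊆ (⋀^ℓ K^{n+1}) ⊗ E as x = ∑_{1≤i₁<⋯<i_ℓ≤n+1} (e_{i₁} ∧ ⋯ ∧ e_{i_ℓ}) ⊗ x_{i₁,…,i_ℓ} with x_{i₁,…,i_ℓ} ∈ E, where (e₁,…,e_{n+1}) is the standard basis of K^{n+1}. Then the number of strictly increasing tuples (i₁,…,i_ℓ) with x_{i₁,…,i_ℓ} ≠ 0 is at least ℓ+1. -/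
open TensorProduct ExteriorAlgebra

set_option synthInstance.maxHeartbeats 1000000
set_option maxHeartbeats 1000000

/-- The alternating form `v ↦ det (g (v r) k)` where the `k`-th coordinate of `g` is the `w k`-th
coordinate function, except that the `k₀`-th one is the coordinate sum. -/
noncomputable def sumDetForm (K : Type*) [Field K] {ι : Type*} [Fintype ι] {ℓ : ℕ}
    (w : Fin ℓ → ι) (k₀ : Fin ℓ) : (ι → K) [⋀^Fin ℓ]→ₗ[K] K :=
  (Matrix.detRowAlternating (R := K) (n := Fin ℓ)).compLinearMap
    (LinearMap.pi fun k => if k = k₀ then ∑ j, LinearMap.proj j else LinearMap.proj (w k))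

section sumDetForm

variable {K : Type*} [Field K] {ι : Type*} [Fintype ι] {ℓ : ℕ} (w : Fin ℓ → ι) (k₀ : Fin ℓ)

theorem sumDetForm_apply (v : Fin ℓ → ι → K) :
    sumDetForm K w k₀ v =
      (Matrix.of fun r k => if k = k₀ then ∑ j, v r j else v r (w k)).det := by
  change Matrix.det _ = Matrix.det _
  congr 1
  ext r k
  by_cases h : k = k₀ <;> simp [h]

theorem sumDetForm_eq_zero_of_sum_eq_zero {v : Fin ℓ → ι → K} (hv : ∀ r, ∑ j, v r j = 0) :
    sumDetForm K w k₀ v = 0 := by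
  rw [sumDetForm_apply]
  exact Matrix.det_eq_zero_of_column_eq_zero k₀ fun r => by simp [hv]

theorem sumDetForm_single_eq_zero [DecidableEq ι] {u : Fin ℓ → ι} {k : Fin ℓ} (hk : k ≠ k₀)
    (hu : ∀ r, u r ≠ w k) : sumDetForm K w k₀ (fun r => Pi.single (u r) 1) = 0 := by
  rw [sumDetForm_apply]
  exact Matrix.det_eq_zero_of_column_eq_zero k fun r => by simp [hk, (hu r).symm]

theorem sumDetForm_single_self [DecidableEq ι] (hw : Function.Injective w) :
    sumDetForm K w k₀ (fun r => Pi.single (w r) 1) = 1 := by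
  rw [sumDetForm_apply]
  have : (Matrix.of fun r k => if k = k₀ then ∑ j, (Pi.single (w r) 1 : ι → K) j
      else (Pi.single (w r) 1 : ι → K) (w k)) =
      (1 : Matrix (Fin ℓ) (Fin ℓ) K).updateCol k₀ 1 := by
    ext r k
    by_cases h : k = k₀
    · subst h
      simp
    · simp [h, Matrix.one_apply, Pi.single_apply, hw.eq_iff, eq_comm (a := k)]
  rw [this, ← Matrix.cramer_apply, Matrix.cramer_one]
  rfl

end sumDetForm

/-- The linear form on the exterior algebra which is `f` in degree `ℓ` and zero in the other
degrees. -/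
noncomputable def ExteriorAlgebra.liftDegree {K M : Type*} [Field K] [AddCommGroup M] [Module K M]
    {ℓ : ℕ} (f : M [⋀^Fin ℓ]→ₗ[K] K) : ExteriorAlgebra K M →ₗ[K] K :=
  liftAlternating (Pi.single ℓ f)

@[simp]
theorem ExteriorAlgebra.liftDegree_ιMulti {K M : Type*} [Field K] [AddCommGroup M] [Module K M]
    {ℓ : ℕ} (f : M [⋀^Fin ℓ]→ₗ[K] K) (v : Fin ℓ → M) : liftDegree f (ιMulti K ℓ v) = f v := by
  simp [liftDegree, liftAlternating_apply_ιMulti]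

theorem ExteriorAlgebra.liftDegree_map_subtype_eq_zero {K M : Type*} [Field K] [AddCommGroup M]
    [Module K M] {ℓ : ℕ} {f : M [⋀^Fin ℓ]→ₗ[K] K} {A : Submodule K M}
    (hf : ∀ v : Fin ℓ → M, (∀ r, v r ∈ A) → f v = 0)
    {y : ExteriorAlgebra K A} (hy : y ∈ ⋀[K]^ℓ A) : liftDegree f (map A.subtype y) = 0 := by
  rw [← ιMulti_span_fixedDegree] at hy
  induction hy using Submodule.span_induction with
  | mem y hy =>
    obtain ⟨v, rfl⟩ := hy
    rw [map_apply_ιMulti, liftDegree_ιMulti]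
    exact hf _ fun r => (v r).2
  | zero => simp
  | add y z _ _ hy hz => simp [hy, hz]
  | smul a y _ hy => simp [hy]

/-- If a component `c s` of an element of `(⋀^ℓ A) ⊗ E` is nonzero, then for every `i ∈ s` there is
another nonzero component whose index contains `s \ {i}` but not `i`. -/
theorem exists_nonzero_component_ne {K : Type*} [Field K] {n ℓ : ℕ}
    {E : Type*} [AddCommGroup E] [Module K E] {A : Submodule K (Fin n → K)}
    (hA : ∀ y ∈ A, ∑ j, y j = 0)
    {x : (ExteriorAlgebra K (Fin n → K)) ⊗[K] E}
    (hmem : x ∈ LinearMap.range (TensorProduct.map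
      ((ExteriorAlgebra.map A.subtype).toLinearMap.comp (Submodule.subtype (⋀[K]^ℓ A)))
      (LinearMap.id : E →ₗ[K] E)))
    {c : Set.powersetCard (Fin n) ℓ → E}
    (hc : x = ∑ s, (ExteriorAlgebra.ιMulti_family K ℓ
        (fun i => Pi.single i (1 : K)) s) ⊗ₜ[K] c s)
    {s : Set.powersetCard (Fin n) ℓ} (hs : c s ≠ 0) {i : Fin n} (hi : i ∈ s.1) :
    ∃ t : Set.powersetCard (Fin n) ℓ, c t ≠ 0 ∧ s.1.erase i ⊆ t.1 ∧ i ∉ t.1 := by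
  by_contra! h
  set w := Set.powersetCard.ofFinEmbEquiv.symm s
  obtain ⟨k₀, rfl⟩ : i ∈ Set.range w :=
    (Set.powersetCard.mem_range_ofFinEmbEquiv_symm_iff_mem s i).2 hi
  set Φ := (TensorProduct.lid K E).toLinearMap ∘ₗ (liftDegree (sumDetForm K w k₀)).rTensor E with hΦ
  have hx : Φ x = 0 := by
    clear hc
    obtain ⟨y, rfl⟩ := hmem
    induction y with
    | zero => simp
    | add y z hy hz => rw [map_add, map_add, hy, hz, add_zero]
    | tmul y e =>
      have := liftDegree_map_subtype_eq_zero (f := sumDetForm K w k₀) (A := A)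
        (fun v hv => sumDetForm_eq_zero_of_sum_eq_zero w k₀ fun r => hA _ (hv r)) y.2
      simp [hΦ, this]
  have hterm (t : Set.powersetCard (Fin n) ℓ) :
      Φ (ιMulti_family K ℓ (fun i => Pi.single i (1 : K)) t ⊗ₜ[K] c t) =
        sumDetForm K w k₀ (fun r => Pi.single (Set.powersetCard.ofFinEmbEquiv.symm t r) 1) • c t := by
    simp only [hΦ, ιMulti_family, LinearMap.comp_apply, LinearMap.rTensor_tmul, liftDegree_ιMulti]
    rfl
  rw [hc, map_sum, Finset.sum_eq_single s, hterm, sumDetForm_single_self w k₀ w.injective,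
    one_smul] at hx
  · exact hs hx
  · intro t _ hts
    rw [hterm]
    by_cases hct : c t = 0
    · rw [hct, smul_zero]
    by_cases hsub : s.1.erase (w k₀) ⊆ t.1
    · have hst : s.1 ⊆ t.1 := by
        rw [← Finset.insert_erase hi]
        exact Finset.insert_subset (h t hct hsub) hsub
      exact absurd (Set.powersetCard.eq_iff_subset.2 hst).symm hts
    · obtain ⟨j, hj, hjt⟩ := Finset.not_subset.1 hsub
      obtain ⟨k, rfl⟩ : j ∈ Set.range w :=
        (Set.powersetCard.mem_range_ofFinEmbEquiv_symm_iff_mem s j).2 (Finset.mem_of_mem_erase hj)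
      rw [sumDetForm_single_eq_zero w k₀ (k := k), zero_smul]
      · rintro rfl
        simp at hj
      · intro r hr
        exact hjt ((Set.powersetCard.mem_range_ofFinEmbEquiv_symm_iff_mem t _).1 ⟨r, hr⟩)
  · simp

/-- Let `K` be a field of characteristic zero, `1 ≤ ℓ ≤ n`, `E` a
finite-dimensional `K`-vector space, and `A ⊆ K^{n+1}` the hyperplane of vectors
of coordinate sum zero.  Let `x` be a nonzero element of `(⋀^ℓ A) ⊗ E`, viewed
inside `(⋀^ℓ K^{n+1}) ⊗ E` (itself sitting inside `ExteriorAlgebra K K^{n+1} ⊗ E`),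
written as `x = ∑_{s} (e_{i₁} ∧ ⋯ ∧ e_{i_ℓ}) ⊗ c_s` over the subsets
`s = {i₁ < ⋯ < i_ℓ}` of `{1, …, n+1}`, where `(e_i)` is the standard basis.
Then at least `ℓ+1` of the components `c_s` are nonzero. -/
theorem card_nonzero_components_ge {K : Type*} [Field K] [CharZero K]
    (n ℓ : ℕ) (hn : 1 ≤ n) (hl1 : 1 ≤ ℓ) (hln : ℓ ≤ n)
    {E : Type*} [AddCommGroup E] [Module K E] [FiniteDimensional K E]
    (A : Submodule K (Fin (n + 1) → K))
    (hA : ∀ y : Fin (n + 1) → K, y ∈ A ↔ ∑ j, y j = 0)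
    (x : (ExteriorAlgebra K (Fin (n + 1) → K)) ⊗[K] E)
    (hmem : x ∈ LinearMap.range (TensorProduct.map
      ((ExteriorAlgebra.map A.subtype).toLinearMap.comp (Submodule.subtype (⋀[K]^ℓ A)))
      (LinearMap.id : E →ₗ[K] E)))
    (hx0 : x ≠ 0)
    (c : {s : Finset (Fin (n + 1)) // s.card = ℓ} → E)
    (hc : x = ∑ s, (ExteriorAlgebra.ιMulti_family K ℓ
        (fun i => Pi.single i (1 : K)) s) ⊗ₜ[K] c s) :
    ℓ + 1 ≤ Nat.card {s : {s : Finset (Fin (n + 1)) // s.card = ℓ} // c s ≠ 0} := by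
  obtain ⟨s, hs⟩ : ∃ s, c s ≠ 0 := by
    by_contra! h
    exact hx0 (hc.trans (Finset.sum_eq_zero fun s _ => by rw [h s, tmul_zero]))
  choose t ht hsub hnot using fun i : s.1 =>
    exists_nonzero_component_ne (fun y hy => (hA y).1 hy) hmem hc hs i.2
  let f : Option s.1 → {s : {s : Finset (Fin (n + 1)) // s.card = ℓ} // c s ≠ 0} :=
    fun o => o.elim ⟨s, hs⟩ fun i => ⟨t i, ht i⟩
  have hne (i : s.1) : s ≠ t i := fun h => hnot i (h ▸ i.2)
  have hf : Function.Injective f := by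
    rintro (_ | i) (_ | j) hij
    · rfl
    · exact absurd (congrArg Subtype.val hij) (hne j)
    · exact absurd (congrArg Subtype.val hij).symm (hne i)
    · have hij' : t i = t j := congrArg Subtype.val hij
      by_contra hne'
      have hij_ne : (i : Fin (n + 1)) ≠ j := fun h => hne' (by rw [Subtype.ext h])
      exact hnot i (hij' ▸ hsub j (Finset.mem_erase.2 ⟨hij_ne, i.2⟩))
  simpa [s.2] using Nat.card_le_card_of_injective f hf
end
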